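/- Let (R, m) be a complete Noetherian local ring and let M be a finite (finitely generated) R-module of Krull dimension n ≥ 1. Then for every subset T of Assh_R(M) there exists an ideal a of R such that Att_R(H^n_a(M)) = T. -/

import Mathlib

/-!
Top local cohomology modules with specified attached primes (Dibaei–Jafari).

STATEMENT 0: Let `(R, m)` be a complete Noetherian local ring and `M` a finite `R`-module of
Krull dimension `n ≥ 1`.  Then for every subset `T` of `Assh_R(M)` there is an ideal `a` of `R`
with `Att_R(H^n_a(M)) = T`.
-/

open CategoryTheory

noncomputable section

universe u

/-- A prime ideal `p` is an *attached prime* of the `R`-module `N` if `p` is the annihilator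
of some quotient of `N`. -/
def attachedPrimes (R : Type u) [CommRing R] (N : Type u) [AddCommGroup N] [Module R N] :
    Set (Ideal R) :=
  { p | p.IsPrime ∧ ∃ K : Submodule R N, p = Module.annihilator R (N ⧸ K) }

/-- `Assh_R(M)`: the associated primes `p` of `M` with `dim (R ⧸ p) = dim M`, where the
dimension of `M` is recorded by the natural number `n`. -/
def assh (R : Type u) [CommRing R] (M : Type u) [AddCommGroup M] [Module R M] (n : ℕ) :
    Set (Ideal R) :=
  { p ∈ associatedPrimes R M | ringKrullDim (R ⧸ p) = (n : WithBot (WithTop ℕ)) }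

section Comparison

lemma lc_abs {V : Type*} [Category V] {A B C A' B' C' : V} {m : A ⟶ A'} {b : A ⟶ B} {a : B ⟶ C}
    {b' : A' ⟶ B'} {a' : B' ⟶ C'} {h : B ⟶ B'} {e : C ⟶ C'} (h2 : m ≫ b' = b ≫ h)
    (h1 : a ≫ e = h ≫ a') : (b ≫ a) ≫ e = m ≫ (b' ≫ a') := by
  rw [Category.assoc, h1, ← Category.assoc, ← Category.assoc, h2]

lemma lc_homologyUnop_nat {V : Type*} [Category V] [Abelian V] {ι : Type*} {c : ComplexShape ι}
    {K L : HomologicalComplex Vᵒᵖ c} (φ : K ⟶ L) (i : ι) :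
    HomologicalComplex.homologyMap ((HomologicalComplex.unopFunctor V c).map φ.op) i ≫ (K.homologyUnop i).hom
     = (L.homologyUnop i).hom ≫ (HomologicalComplex.homologyMap φ i).unop := by
  have h := HomologicalComplex.homologyOp_hom_naturality ((HomologicalComplex.unopFunctor V c).map φ.op) i
  have h2 := congrArg Quiver.Hom.unop h
  exact h2.symm

variable {R : Type u} [CommRing R]

def lcYmap {C D : ChainComplex (ModuleCat.{u} R) ℕ} (φ : C ⟶ D) (Y : ModuleCat.{u} R) :
    D.linearYonedaObj R Y ⟶ C.linearYonedaObj R Y :=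
  (HomologicalComplex.unopFunctor _ _).map
    ((((linearYoneda R (ModuleCat.{u} R)).obj Y).rightOp.mapHomologicalComplex _).map φ).op

lemma lcYmap_f {C D : ChainComplex (ModuleCat.{u} R) ℕ} (φ : C ⟶ D) (Y : ModuleCat.{u} R) (n : ℕ)
   (f : D.X n ⟶ Y) : ((lcYmap φ Y).f n).hom f = φ.f n ≫ f := rfl

lemma lc_isoExt_nat {X X' : ModuleCat.{u} R} (g : X' ⟶ X) (P : ProjectiveResolution X)
    (P' : ProjectiveResolution X') (φ : P'.Hom P g) (Y : ModuleCat.{u} R) (n : ℕ) :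
    ((Ext R (ModuleCat.{u} R) n).map g.op).app Y ≫ (P'.isoExt (R := R) n Y).hom =
      (P.isoExt (R := R) n Y).hom ≫ HomologicalComplex.homologyMap (lcYmap φ.hom Y) n := by
  have h1 := ProjectiveResolution.isoLeftDerivedObj_hom_naturality g P' P φ.hom φ.hom_f_zero_comp_π_f_zero
    ((linearYoneda R (ModuleCat.{u} R)).obj Y).rightOp n
  have h2 := lc_homologyUnop_nat ((((linearYoneda R (ModuleCat.{u} R)).obj Y).rightOp.mapHomologicalComplex (ComplexShape.down ℕ)).map φ.hom) n
  have h1' := congrArg Quiver.Hom.unop h1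
  rw [← Iso.inv_comp_eq, ← Category.assoc, ← Iso.eq_comp_inv]
  exact lc_abs h2 h1'

lemma lc_cocycle {X : ModuleCat.{u} R} (P : ProjectiveResolution X) (Y : ModuleCat.{u} R) (n : ℕ)
    (z : (P.complex.linearYonedaObj R Y).cycles n) :
    P.complex.d (n+1) n ≫ (((P.complex.linearYonedaObj R Y).iCycles n).hom z) = 0 :=
  congrArg (fun f => f.hom z) ((P.complex.linearYonedaObj R Y).iCycles_d n (n+1))

/-- the new class of a cocycle -/
def lcNew {X : ModuleCat.{u} R} (P : ProjectiveResolution X) (Y : ModuleCat.{u} R) (n : ℕ) :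
    (P.complex.linearYonedaObj R Y).cycles n →ₗ[R] Abelian.Ext X Y n where
  toFun z := P.extMk (((P.complex.linearYonedaObj R Y).iCycles n).hom z) (n+1) rfl (by
     have := congrArg (fun f => f.hom z) ((P.complex.linearYonedaObj R Y).iCycles_d n (n+1))
     exact this)
  map_add' f g := by
     simp only [map_add]
     exact (P.add_extMk _ _ (n+1) rfl _ _).symm
  map_smul' r f := by
    have := P.extMk_comp_mk₀ (((P.complex.linearYonedaObj R Y).iCycles n).hom f) (n+1) rfl (by
     have := congrArg (fun h => h.hom f) ((P.complex.linearYonedaObj R Y).iCycles_d n (n+1))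
     exact this) (r • 𝟙 Y)
    simp only [RingHom.id_apply]
    rw [Abelian.Ext.smul_eq_comp_mk₀, this]
    congr 1
    simp only [map_smul]
    rfl

lemma lcNew_surj {X : ModuleCat.{u} R} (P : ProjectiveResolution X) (Y : ModuleCat.{u} R) (n : ℕ) :
    Function.Surjective (lcNew P Y n) := by
  intro α
  obtain ⟨f, hf, rfl⟩ := P.extMk_surjective α (n+1) rfl
  refine ⟨(P.complex.linearYonedaObj R Y).cyclesMk f (n+1) (by simp) hf, ?_⟩
  have : ((P.complex.linearYonedaObj R Y).iCycles n).hom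
     ((P.complex.linearYonedaObj R Y).cyclesMk f (n+1) (by simp) hf) = f :=
    HomologicalComplex.i_cyclesMk (P.complex.linearYonedaObj R Y) f (n+1) (by simp) hf
  simp only [lcNew, LinearMap.coe_mk, AddHom.coe_mk, this]

lemma lcNew_ker {X : ModuleCat.{u} R} (P : ProjectiveResolution X) (Y : ModuleCat.{u} R) (n : ℕ) :
    LinearMap.ker (lcNew P Y (n+1)) =
      LinearMap.ker ((P.complex.linearYonedaObj R Y).homologyπ (n+1)).hom := by
  ext z
  rw [LinearMap.mem_ker, LinearMap.mem_ker]
  have hinj : Function.Injective ((P.complex.linearYonedaObj R Y).iCycles (n+1)).hom :=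
    (ModuleCat.mono_iff_injective _).1 inferInstance
  have hexact : (ShortComplex.mk _ _ ((P.complex.linearYonedaObj R Y).toCycles_comp_homologyπ n (n+1))).Exact :=
    ShortComplex.exact_of_g_is_cokernel _ ((P.complex.linearYonedaObj R Y).homologyIsCokernel n (n+1) (by simp))
  rw [ShortComplex.moduleCat_exact_iff] at hexact
  have key : ((P.complex.linearYonedaObj R Y).homologyπ (n+1)).hom z = 0 ↔
      ∃ g, ((P.complex.linearYonedaObj R Y).toCycles n (n+1)).hom g = z := by
    constructor
    · exact hexact z
    · rintro ⟨g, rfl⟩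
      rw [← LinearMap.comp_apply, ← ModuleCat.hom_comp, HomologicalComplex.toCycles_comp_homologyπ]
      rfl
  rw [key]
  refine (P.extMk_eq_zero_iff _ (n+2) rfl (lc_cocycle P Y (n+1) z) n rfl).trans ?_
  refine exists_congr fun g => ?_
  have h1 : ((P.complex.linearYonedaObj R Y).iCycles (n+1)).hom
      (((P.complex.linearYonedaObj R Y).toCycles n (n+1)).hom g) =
      ((P.complex.linearYonedaObj R Y).d n (n+1)).hom g :=
    congrArg (fun f => f.hom g) ((P.complex.linearYonedaObj R Y).toCycles_i n (n+1))
  have h2 : ((P.complex.linearYonedaObj R Y).d n (n+1)).hom g = P.complex.d (n+1) n ≫ g := rfl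
  constructor
  · intro h
    exact hinj (h1.trans (h2.trans h))
  · intro h
    subst h
    exact (h1.trans h2).symm

/-- homology of the hom complex is the new ext -/
def lcE {X : ModuleCat.{u} R} (P : ProjectiveResolution X) (Y : ModuleCat.{u} R) (n : ℕ) :
    (P.complex.linearYonedaObj R Y).homology (n+1) ≃ₗ[R] Abelian.Ext X Y (n+1) :=
  (LinearMap.quotKerEquivOfSurjective ((P.complex.linearYonedaObj R Y).homologyπ (n+1)).hom
    ((ModuleCat.epi_iff_surjective _).1 inferInstance)).symm.trans
  ((Submodule.quotEquivOfEq _ _ (lcNew_ker P Y n).symm).trans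
    (LinearMap.quotKerEquivOfSurjective _ (lcNew_surj P Y (n+1))))

lemma lcE_apply {X : ModuleCat.{u} R} (P : ProjectiveResolution X) (Y : ModuleCat.{u} R) (n : ℕ)
    (z : (P.complex.linearYonedaObj R Y).cycles (n+1)) :
    lcE P Y n (((P.complex.linearYonedaObj R Y).homologyπ (n+1)).hom z) = lcNew P Y (n+1) z := by
  have h : (LinearMap.quotKerEquivOfSurjective ((P.complex.linearYonedaObj R Y).homologyπ (n+1)).hom
    ((ModuleCat.epi_iff_surjective _).1 inferInstance)).symm
     (((P.complex.linearYonedaObj R Y).homologyπ (n+1)).hom z) = Submodule.Quotient.mk z := by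
    rw [LinearEquiv.symm_apply_eq]; rfl
  simp only [lcE, LinearEquiv.trans_apply, h]
  rfl

lemma lcE_nat {X X' : ModuleCat.{u} R} (g : X' ⟶ X) (P : ProjectiveResolution X)
    (P' : ProjectiveResolution X') (φ : P'.Hom P g) (Y : ModuleCat.{u} R) (n : ℕ)
    (z : (P.complex.linearYonedaObj R Y).homology (n+1)) :
    lcE P' Y n ((HomologicalComplex.homologyMap (lcYmap φ.hom Y) (n+1)).hom z) =
     (Abelian.Ext.mk₀ g).comp (lcE P Y n z) (zero_add _) := by
  obtain ⟨z, rfl⟩ : ∃ y, ((P.complex.linearYonedaObj R Y).homologyπ (n+1)).hom y = z :=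
    (ModuleCat.epi_iff_surjective _).1 inferInstance z
  rw [lcE_apply, ← LinearMap.comp_apply, ← ModuleCat.hom_comp,
    HomologicalComplex.homologyπ_naturality, ModuleCat.hom_comp, LinearMap.comp_apply, lcE_apply]
  simp only [lcNew, LinearMap.coe_mk, AddHom.coe_mk]
  refine Eq.trans ?_ (ProjectiveResolution.mk₀_comp_extMk _ _ rfl (lc_cocycle P Y (n+1) z) φ).symm
  have h1 : ((P'.complex.linearYonedaObj R Y).iCycles (n+1)).hom
      ((HomologicalComplex.cyclesMap (lcYmap φ.hom Y) (n+1)).hom z) =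
      ((lcYmap φ.hom Y).f (n+1)).hom (((P.complex.linearYonedaObj R Y).iCycles (n+1)).hom z) :=
    congrArg (fun f => f.hom z) (HomologicalComplex.cyclesMap_i (lcYmap φ.hom Y) (n+1))
  have h2 : ∀ (f f' : P'.complex.X (n+1) ⟶ Y) (hf : P'.complex.d (n+2) (n+1) ≫ f = 0)
      (hf' : P'.complex.d (n+2) (n+1) ≫ f' = 0), f = f' →
      P'.extMk f (n+2) rfl hf = P'.extMk f' (n+2) rfl hf' := by
    rintro f f' hf hf' rfl; rfl
  exact h2 _ _ _ _ h1

/-- lift of resolutions -/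
def lcLift {X X' : ModuleCat.{u} R} (g : X' ⟶ X) (P : ProjectiveResolution X)
    (P' : ProjectiveResolution X') : P'.Hom P g where
  hom := ProjectiveResolution.lift g P' P
  hom_f_zero_comp_π_f_zero := by
    have := ProjectiveResolution.lift_commutes g P' P
    exact congrArg (fun f => f.f 0) this

/-- comparison -/
def lcCmp (X Y : ModuleCat.{u} R) (n : ℕ) :
    (((Ext R (ModuleCat.{u} R) (n+1)).obj (Opposite.op X)).obj Y) ≃ₗ[R] Abelian.Ext X Y (n+1) :=
  ((projectiveResolution X).isoExt (R := R) (n+1) Y).toLinearEquiv.trans (lcE _ Y n)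

lemma lcCmp_nat {X X' : ModuleCat.{u} R} (g : X' ⟶ X) (Y : ModuleCat.{u} R) (n : ℕ)
    (z : ((Ext R (ModuleCat.{u} R) (n+1)).obj (Opposite.op X)).obj Y) :
    lcCmp X' Y n ((((Ext R (ModuleCat.{u} R) (n+1)).map g.op).app Y).hom z) =
     (Abelian.Ext.mk₀ g).comp (lcCmp X Y n z) (zero_add _) := by
  have h := lc_isoExt_nat g (projectiveResolution X) (projectiveResolution X') (lcLift g _ _) Y (n+1)
  have h' := congrArg (fun f => f.hom z) h
  simp only [ModuleCat.hom_comp, LinearMap.comp_apply] at h'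
  change lcE _ _ _ (((projectiveResolution X').isoExt (R := R) (n+1) Y).hom.hom _) = _
  rw [h', lcE_nat]
  rfl
end Comparison

section Comparison2
variable {R : Type u} [CommRing R]

/-- quotient by a power -/
abbrev lcQ (a : Ideal R) (t : ℕ) : ModuleCat.{u} R :=  ModuleCat.of R (R ⧸ a ^ t)

/-- transition -/
def lcq (a : Ideal R) {s t : ℕ} (h : s ≤ t) : lcQ a t ⟶ lcQ a s :=
  ModuleCat.ofHom (Submodule.mapQ _ _ LinearMap.id (Ideal.pow_le_pow_right h))

lemma lcq_self (a : Ideal R) (s : ℕ) : lcq a (le_refl s) = 𝟙 _ := by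
  ext; rfl

lemma lcq_comp (a : Ideal R) {s t r : ℕ} (h : s ≤ t) (h' : t ≤ r) :
    lcq a h' ≫ lcq a h = lcq a (h.trans h') := by
  ext; rfl

/-- precomposition -/
def lcTr (a : Ideal R) (n : ℕ) (Y : ModuleCat.{u} R) (s t : ℕ) (h : s ≤ t) :
    Abelian.Ext (lcQ a s) Y n →ₗ[R] Abelian.Ext (lcQ a t) Y n where
  toFun x := (Abelian.Ext.mk₀ (lcq a h)).comp x (zero_add _)
  map_add' x y := by simp
  map_smul' r x := by simp

instance lc_ds (a : Ideal R) (n : ℕ) (Y : ModuleCat.{u} R) :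
    DirectedSystem (fun t : ℕ => Abelian.Ext (lcQ a t) Y n) (fun s t h => lcTr a n Y s t h) where
  map_self s x := by
    simp [lcTr, lcq_self]
  map_map {k j i} h1 h2 x := by
    simp only [lcTr, LinearMap.coe_mk, AddHom.coe_mk]
    rw [Abelian.Ext.mk₀_comp_mk₀_assoc, lcq_comp]

/-- local cohomology model -/
abbrev LC (a : Ideal R) (n : ℕ) (M : Type u) [AddCommGroup M] [Module R M] : Type u :=
  Module.DirectLimit (fun t : ℕ => Abelian.Ext (lcQ a t) (ModuleCat.of R M) n) (lcTr a n (ModuleCat.of R M))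

abbrev lcF (a : Ideal R) (n : ℕ) := localCohomology.diagram (localCohomology.idealPowersDiagram a) n

def lcCoc (a : Ideal R) (n : ℕ) (Y : ModuleCat.{u} R) :=
  ((evaluation (ModuleCat.{u} R) (ModuleCat.{u} R)).obj Y).mapCocone (Limits.colimit.cocone (lcF a n))

def lcCocIs (a : Ideal R) (n : ℕ) (Y : ModuleCat.{u} R) : Limits.IsColimit (lcCoc a n Y) :=
  Limits.isColimitOfPreserves _ (Limits.colimit.isColimit (lcF a n))

def lcι (a : Ideal R) (n : ℕ) (Y : ModuleCat.{u} R) (t : ℕ) :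
    ((Ext R (ModuleCat.{u} R) n).obj (Opposite.op (lcQ a t))).obj Y →ₗ[R]
      (localCohomology a n).obj Y :=
  ((lcCoc a n Y).ι.app (Opposite.op (Opposite.op t))).hom

lemma lcι_w (a : Ideal R) (n : ℕ) (Y : ModuleCat.{u} R) {s t : ℕ} (h : s ≤ t) (z) :
    lcι a n Y t ((((Ext R (ModuleCat.{u} R) n).map (lcq a h).op).app Y).hom z) = lcι a n Y s z :=
  congrArg (fun f => f.hom z) ((lcCoc a n Y).w
      ((homOfLE h).op.op : Opposite.op (Opposite.op s) ⟶ Opposite.op (Opposite.op t)))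

instance lc_pres (F : ℕᵒᵖᵒᵖ ⥤ ModuleCat.{u} R) : Limits.PreservesColimit F (forget (ModuleCat.{u} R)) := by
  have h : Limits.PreservesFilteredColimitsOfSize.{u,u} (forget (ModuleCat.{u} R)) := inferInstance
  have h2 : Limits.PreservesFilteredColimitsOfSize.{0,0} (forget (ModuleCat.{u} R)) :=
    Limits.preservesFilteredColimitsOfSize_shrink.{0,u,0,u} _
  have : Limits.PreservesColimitsOfShape ℕᵒᵖᵒᵖ (forget (ModuleCat.{u} R)) :=
    h2.preserves_filtered_colimits _
  infer_instance

lemma lcι_surj (a : Ideal R) (n : ℕ) (Y : ModuleCat.{u} R) (y) :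
    ∃ t z, lcι a n Y t z = y := by
  obtain ⟨k, z, hz⟩ := Limits.Concrete.isColimit_exists_rep _ (lcCocIs a n Y) y
  exact ⟨k.unop.unop, z, hz⟩

lemma lcι_zero (a : Ideal R) (n : ℕ) (Y : ModuleCat.{u} R) (s z) (hz : lcι a n Y s z = 0) :
    ∃ t, ∃ h : s ≤ t, (((Ext R (ModuleCat.{u} R) n).map (lcq a h).op).app Y).hom z = 0 := by
  obtain ⟨k, f, g, hk⟩ := Limits.Concrete.isColimit_exists_of_rep_eq _ (lcCocIs a n Y)
    (i := Opposite.op (Opposite.op s)) (j := Opposite.op (Opposite.op s)) z 0 (hz.trans (map_zero (lcι a n Y s)).symm)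
  exact ⟨k.unop.unop, f.unop.unop.le, hk.trans (map_zero _)⟩

def lcCompMap (a : Ideal R) (n : ℕ) (M : Type u) [AddCommGroup M] [Module R M] :
    LC a (n+1) M →ₗ[R] (localCohomology a (n+1)).obj (ModuleCat.of R M) :=
  Module.DirectLimit.lift _ _ _ _ (fun t => lcι a (n+1) (ModuleCat.of R M) t ∘ₗ
      (lcCmp (lcQ a t) (ModuleCat.of R M) n).symm.toLinearMap) (by
    intro s t h x
    obtain ⟨z, rfl⟩ := (lcCmp (lcQ a s) (ModuleCat.of R M) n).surjective x
    have h1 := lcCmp_nat (lcq a h) (ModuleCat.of R M) n z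
    simp only [LinearMap.comp_apply, LinearEquiv.coe_coe, LinearEquiv.symm_apply_apply]
    have h3 : lcTr a (n+1) (ModuleCat.of R M) s t h ((lcCmp (lcQ a s) (ModuleCat.of R M) n) z) = _ := h1.symm
    rw [h3, LinearEquiv.symm_apply_apply, lcι_w])

lemma lcCompMap_bij (a : Ideal R) (n : ℕ) (M : Type u) [AddCommGroup M] [Module R M] :
    Function.Bijective (lcCompMap a n M) := by
  constructor
  · rw [injective_iff_map_eq_zero]
    intro x hx
    obtain ⟨t, x, rfl⟩ := Module.DirectLimit.exists_of x
    obtain ⟨z, rfl⟩ := (lcCmp (lcQ a t) (ModuleCat.of R M) n).surjective x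
    have hz : lcι a (n+1) (ModuleCat.of R M) t z = 0 := by
      simpa [lcCompMap] using hx
    obtain ⟨k, hle, hk⟩ := lcι_zero _ _ _ _ _ hz
    have h1 := lcCmp_nat (lcq a hle) (ModuleCat.of R M) n z
    rw [hk, map_zero] at h1
    rw [← Module.DirectLimit.of_f (hij := hle)]
    have h3 : lcTr a (n+1) (ModuleCat.of R M) t k hle ((lcCmp (lcQ a t) (ModuleCat.of R M) n) z) = 0 := h1.symm
    rw [h3, map_zero]
  · intro y
    obtain ⟨k, z, hz⟩ := lcι_surj _ _ _ y
    refine ⟨Module.DirectLimit.of _ _ _ _ k ((lcCmp (lcQ a k) (ModuleCat.of R M) n) z), ?_⟩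
    rw [lcCompMap, Module.DirectLimit.lift_of]
    simp only [LinearMap.comp_apply, LinearEquiv.coe_coe, LinearEquiv.symm_apply_apply]
    exact hz

theorem lcComp (a : Ideal R) (n : ℕ) (hn : 1 ≤ n) (M : Type u) [AddCommGroup M] [Module R M] :
    Nonempty (LC a n M ≃ₗ[R] (localCohomology a n).obj (ModuleCat.of R M)) := by
  obtain ⟨n, rfl⟩ : ∃ m, n = m + 1 := ⟨n-1, by omega⟩
  exact ⟨LinearEquiv.ofBijective _ (lcCompMap_bij a n M)⟩
end Comparison2

section LCax
variable {R : Type u} [CommRing R]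

/-- postcomposition on the model -/
def lcPost (a : Ideal R) {n k m : ℕ} (h : n + k = m) {Y Z : ModuleCat.{u} R} (α : Abelian.Ext Y Z k) :
    Module.DirectLimit (fun t : ℕ => Abelian.Ext (lcQ a t) Y n) (lcTr a n Y) →ₗ[R]
    Module.DirectLimit (fun t : ℕ => Abelian.Ext (lcQ a t) Z m) (lcTr a m Z) :=
  Module.DirectLimit.map (fun t =>
    { toFun := fun x => x.comp α h
      map_add' := by intro x y; simp
      map_smul' := by intro r x; simp }) (by
    intro s t hst
    ext x
    simp only [LinearMap.comp_apply, LinearMap.coe_mk, AddHom.coe_mk, lcTr]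
    rw [Abelian.Ext.comp_assoc]
    omega)

abbrev lcOf (a : Ideal R) (n : ℕ) (Y : ModuleCat.{u} R) (t : ℕ) (x : Abelian.Ext (lcQ a t) Y n) :
    Module.DirectLimit (fun t : ℕ => Abelian.Ext (lcQ a t) Y n) (lcTr a n Y) :=
  Module.DirectLimit.of R ℕ _ _ t x

lemma lcPost_of (a : Ideal R) {n k m : ℕ} (h : n + k = m) {Y Z : ModuleCat.{u} R} (α : Abelian.Ext Y Z k)
    (t : ℕ) (x : Abelian.Ext (lcQ a t) Y n) :
    lcPost a h α (lcOf a n Y t x) = lcOf a m Z t (x.comp α h) := by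
  simp [lcPost, lcOf]

lemma lcOf_tr (a : Ideal R) (n : ℕ) (Y : ModuleCat.{u} R) {s t : ℕ} (h : s ≤ t) (x) :
    lcOf a n Y t (lcTr a n Y s t h x) = lcOf a n Y s x := Module.DirectLimit.of_f

lemma lcPost_exact (a : Ideal R) {n k m k' l : ℕ} (h : n + k = m) (h' : m + k' = l) {X Y Z : ModuleCat.{u} R}
    (α : Abelian.Ext X Y k) (β : Abelian.Ext Y Z k')
    (h0 : ∀ t (x : Abelian.Ext (lcQ a t) X n), (x.comp α h).comp β h' = 0)
    (H : ∀ t (y : Abelian.Ext (lcQ a t) Y m), y.comp β h' = 0 → ∃ x : Abelian.Ext (lcQ a t) X n, x.comp α h = y) :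
    Function.Exact (lcPost a h α) (lcPost a h' β) := by
  intro y
  constructor
  · intro hy
    obtain ⟨t, y, rfl⟩ := Module.DirectLimit.exists_of y
    have hy' : lcOf a l Z t (y.comp β h') = 0 := (lcPost_of a h' β t y).symm.trans hy
    obtain ⟨s, hs, h2⟩ := Module.DirectLimit.of.zero_exact hy'
    have h3 : (lcTr a m Y t s hs y).comp β h' = 0 := by
      rw [← h2]
      simp only [LinearMap.coe_mk, AddHom.coe_mk, lcTr]
      rw [Abelian.Ext.comp_assoc]
      omega
    obtain ⟨x, hx⟩ := H s _ h3
    exact ⟨lcOf a n X s x, by rw [lcPost_of, hx, lcOf_tr]⟩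
  · rintro ⟨x, rfl⟩
    obtain ⟨t, x, rfl⟩ := Module.DirectLimit.exists_of x
    have : lcPost a h α (lcOf a n X t x) = _ := lcPost_of a h α t x
    erw [this, lcPost_of, h0]
    exact map_zero _

variable {A B C : Type u} [AddCommGroup A] [Module R A] [AddCommGroup B] [Module R B]
  [AddCommGroup C] [Module R C]

/-- functoriality -/
def lcMap (a : Ideal R) (n : ℕ) (f : A →ₗ[R] B) : LC a n A →ₗ[R] LC a n B :=
  lcPost a (add_zero n) (Abelian.Ext.mk₀ (ModuleCat.ofHom f))

lemma lcMap_of (a : Ideal R) (n : ℕ) (f : A →ₗ[R] B) (t x) : lcMap a n f (lcOf a n _ t x) =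
    lcOf a n (ModuleCat.of R B) t (x.comp (Abelian.Ext.mk₀ (ModuleCat.ofHom f)) (add_zero n)) :=
  lcPost_of _ _ _ _ _

lemma lcMap_id (a : Ideal R) (n : ℕ) : lcMap a n (LinearMap.id : A →ₗ[R] A) = LinearMap.id := by
  refine Module.DirectLimit.hom_ext fun t => LinearMap.ext fun x => ?_
  refine (lcMap_of _ _ _ _ _).trans ?_
  rw [ModuleCat.ofHom_id, Abelian.Ext.comp_mk₀_id]
  rfl

lemma lcMap_comp (a : Ideal R) (n : ℕ) (g : B →ₗ[R] C) (f : A →ₗ[R] B) :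
    lcMap a n (g ∘ₗ f) = lcMap a n g ∘ₗ lcMap a n f := by
  refine Module.DirectLimit.hom_ext fun t => LinearMap.ext fun x => ?_
  refine (lcMap_of _ _ _ _ _).trans ?_
  refine Eq.trans ?_ (congrArg (lcMap a n g) (lcMap_of a n f t x)).symm
  rw [lcMap_of, ModuleCat.ofHom_comp]
  simp

lemma lcMap_add (a : Ideal R) (n : ℕ) (f g : A →ₗ[R] B) :
    lcMap a n (f + g) = lcMap a n f + lcMap a n g := by
  refine Module.DirectLimit.hom_ext fun t => LinearMap.ext fun x => ?_
  refine (lcMap_of _ _ _ _ _).trans ?_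
  refine Eq.trans ?_ (congrArg₂ (· + ·) (lcMap_of a n f t x) (lcMap_of a n g t x)).symm
  rw [ModuleCat.ofHom_add, Abelian.Ext.mk₀_add, Abelian.Ext.comp_add]
  exact map_add _ _ _

lemma lcMap_smul (a : Ideal R) (n : ℕ) (r : R) (f : A →ₗ[R] B) :
    lcMap a n (r • f) = r • lcMap a n f := by
  refine Module.DirectLimit.hom_ext fun t => LinearMap.ext fun x => ?_
  refine (lcMap_of _ _ _ _ _).trans ?_
  refine Eq.trans ?_ (congrArg (r • ·) (lcMap_of a n f t x)).symm
  have : ModuleCat.ofHom (r • f) = r • ModuleCat.ofHom f := rfl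
  rw [this, Abelian.Ext.mk₀_smul]
  simp

/-- the short complex -/
abbrev lcS (f : A →ₗ[R] B) (g : B →ₗ[R] C) (h : Function.Exact f g) : ShortComplex (ModuleCat.{u} R) :=
  ShortComplex.mk (ModuleCat.ofHom f) (ModuleCat.ofHom g) (by
    ext x; exact h.apply_apply_eq_zero x)

lemma lcS_exact (f : A →ₗ[R] B) (g : B →ₗ[R] C) (h : Function.Exact f g) (hf : Function.Injective f)
    (hg : Function.Surjective g) : (lcS f g h).ShortExact where
  exact := by
    rw [ShortComplex.moduleCat_exact_iff]
    intro x hx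
    exact (h x).1 hx
  mono_f := (ModuleCat.mono_iff_injective _).2 hf
  epi_g := (ModuleCat.epi_iff_surjective _).2 hg

lemma lc_exact2 (a : Ideal R) (n : ℕ) (f : A →ₗ[R] B) (g : B →ₗ[R] C) (h : Function.Exact f g) (hf : Function.Injective f)
    (hg : Function.Surjective g) : Function.Exact (lcMap a n f) (lcMap a n g) := by
  have hS := lcS_exact f g h hf hg
  refine lcPost_exact a _ _ _ _ ?_ ?_
  · intro t x
    rw [Abelian.Ext.comp_assoc_of_third_deg_zero, Abelian.Ext.mk₀_comp_mk₀]
    have : ModuleCat.ofHom f ≫ ModuleCat.ofHom g = 0 := (lcS f g h).zero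
    rw [this]; simp
  · intro t y hy
    exact Abelian.Ext.covariant_sequence_exact₂ _ hS y hy

lemma lc_delta (a : Ideal R) (n : ℕ) (f : A →ₗ[R] B) (g : B →ₗ[R] C) (h : Function.Exact f g) (hf : Function.Injective f)
    (hg : Function.Surjective g) : ∃ δ : LC a n C →ₗ[R] LC a (n+1) A, 
      Function.Exact (lcMap a n g) δ ∧ Function.Exact δ (lcMap a (n+1) f) := by
  have hS := lcS_exact f g h hf hg
  refine ⟨lcPost a rfl hS.extClass, ?_, ?_⟩
  · refine lcPost_exact a _ _ _ _ ?_ ?_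
    · intro t x
      rw [Abelian.Ext.comp_assoc_of_second_deg_zero]
      erw [hS.comp_extClass]
      simp
    · intro t y hy
      exact Abelian.Ext.covariant_sequence_exact₃ _ hS y rfl hy
  · refine lcPost_exact a _ _ _ _ ?_ ?_
    · intro t x
      rw [Abelian.Ext.comp_assoc_of_third_deg_zero]
      erw [hS.extClass_comp]
      simp
    · intro t y hy
      exact Abelian.Ext.covariant_sequence_exact₁ _ hS y hy rfl

lemma lc_torsion (a : Ideal R) (n : ℕ) {y : R} (hy : y ∈ a) (x : LC a n A) : ∃ t : ℕ, y ^ t • x = 0 := by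
  obtain ⟨t, x, rfl⟩ := Module.DirectLimit.exists_of x
  refine ⟨t, ?_⟩
  have h1 : (y ^ t) • (𝟙 (lcQ a t)) = 0 := by
    ext
    show Ideal.Quotient.mk (a ^ t) (y ^ t * 1) = 0
    rw [mul_one, Ideal.Quotient.eq_zero_iff_mem]
    exact Ideal.pow_mem_pow hy t
  have h2 : y ^ t • x = 0 := by
    rw [← Abelian.Ext.mk₀_id_comp x, ← Abelian.Ext.smul_comp, ← Abelian.Ext.mk₀_smul, h1]
    simp
  erw [← map_smul, h2, map_zero]

lemma lc_injective (a : Ideal R) (n : ℕ) [Module.Injective R A] : Subsingleton (LC a (n+1) A) := by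
  have : Injective (ModuleCat.of R A) := Module.injective_object_of_injective_module R A
  refine subsingleton_of_forall_eq 0 fun x => ?_
  obtain ⟨t, x, rfl⟩ := Module.DirectLimit.exists_of x
  have := Abelian.Ext.subsingleton_of_injective (lcQ a t) (ModuleCat.of R A) n
  rw [Subsingleton.elim x 0, map_zero]

/-- degree zero -/
def lcEv0 (a : Ideal R) (A : Type u) [AddCommGroup A] [Module R A] (t : ℕ) :
    Abelian.Ext (lcQ a t) (ModuleCat.of R A) 0 →ₗ[R] A where
  toFun x := (Abelian.Ext.linearEquiv₀ (R := R) x).hom (Ideal.Quotient.mk (a ^ t) 1)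
  map_add' := by intro x y; simp
  map_smul' := by intro x y; simp

lemma lcEv0_mk (a : Ideal R) (t : ℕ) (f : lcQ a t ⟶ ModuleCat.of R A) :
    lcEv0 a A t (Abelian.Ext.mk₀ f) = f.hom (Ideal.Quotient.mk (a ^ t) 1) := by
  have : Abelian.Ext.linearEquiv₀ (R := R) (Abelian.Ext.mk₀ f) = f := by
    apply (Abelian.Ext.mk₀_bijective _ _).1
    simp
  simp [lcEv0, this]

/-- degree zero -/
def lcEv (a : Ideal R) (A : Type u) [AddCommGroup A] [Module R A] : LC a 0 A →ₗ[R] A :=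
  Module.DirectLimit.lift _ _ _ _ (lcEv0 a A) (by
    intro s t h x
    obtain ⟨f, rfl⟩ := (Abelian.Ext.mk₀_bijective _ _).2 x
    simp only [lcTr, LinearMap.coe_mk, AddHom.coe_mk]
    rw [Abelian.Ext.mk₀_comp_mk₀, lcEv0_mk, lcEv0_mk]
    rfl)

lemma lcEv_of (a : Ideal R) (t : ℕ) (f : lcQ a t ⟶ ModuleCat.of R A) :
    lcEv a A (lcOf a 0 _ t (Abelian.Ext.mk₀ f)) = f.hom (Ideal.Quotient.mk (a ^ t) 1) := by
  rw [← lcEv0_mk]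
  simp [lcEv, lcOf]

lemma lc_hom_ext (a : Ideal R) (t : ℕ) (f g : lcQ a t ⟶ ModuleCat.of R A)
    (h : f.hom (Ideal.Quotient.mk (a ^ t) 1) = g.hom (Ideal.Quotient.mk (a ^ t) 1)) : f = g := by
  apply ModuleCat.hom_ext
  refine Submodule.linearMap_qext _ (LinearMap.ext_ring ?_)
  exact h

lemma lcEv_inj (a : Ideal R) : Function.Injective (lcEv a A) := by
  rw [injective_iff_map_eq_zero]
  intro x hx
  obtain ⟨t, x, rfl⟩ := Module.DirectLimit.exists_of x
  obtain ⟨f, rfl⟩ := (Abelian.Ext.mk₀_bijective _ _).2 x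
  have h := (lcEv_of a t f).symm.trans hx
  have : f = 0 := lc_hom_ext a t f 0 h
  rw [this, Abelian.Ext.mk₀_zero, map_zero]

lemma lcEv_nat (a : Ideal R) (g : A →ₗ[R] B) (x : LC a 0 A) : lcEv a B (lcMap a 0 g x) = g (lcEv a A x) := by
  obtain ⟨t, x, rfl⟩ := Module.DirectLimit.exists_of x
  obtain ⟨f, rfl⟩ := (Abelian.Ext.mk₀_bijective _ _).2 x
  have h := lcMap_of a 0 g t (Abelian.Ext.mk₀ f)
  rw [Abelian.Ext.mk₀_comp_mk₀] at h
  refine (congrArg (lcEv a B) h).trans ?_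
  rw [lcEv_of]
  refine Eq.trans ?_ (congrArg g (lcEv_of a t f)).symm
  rfl

lemma lcEv_surj (a : Ideal R) (x : A) (t : ℕ) (h : ∀ r ∈ a ^ t, r • x = 0) : ∃ y, lcEv a A y = x := by
  let f : lcQ a t ⟶ ModuleCat.of R A := ModuleCat.ofHom
    (Submodule.liftQ (a ^ t) (LinearMap.toSpanSingleton R A x) (fun r hr => h r hr))
  refine ⟨lcOf a 0 _ t (Abelian.Ext.mk₀ f), ?_⟩
  rw [lcEv_of]
  show (1 : R) • x = x
  simp

lemma lcEv_tors (a : Ideal R) (x : LC a 0 A) : ∃ t : ℕ, ∀ r ∈ a ^ t, r • lcEv a A x = 0 := by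
  obtain ⟨t, x, rfl⟩ := Module.DirectLimit.exists_of x
  obtain ⟨f, rfl⟩ := (Abelian.Ext.mk₀_bijective _ _).2 x
  refine ⟨t, fun r hr => ?_⟩
  refine (congrArg (r • ·) (lcEv_of a t f)).trans ?_
  simp only
  rw [← map_smul]
  have : r • (Ideal.Quotient.mk (a ^ t) 1) = 0 := by
    show Ideal.Quotient.mk (a ^ t) (r * 1) = 0
    rw [mul_one, Ideal.Quotient.eq_zero_iff_mem]
    exact hr
  erw [this, map_zero]

lemma lc_zero_inj (a : Ideal R) (g : A →ₗ[R] B) (hg : Function.Injective g) :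
    Function.Injective (lcMap a 0 g) := by
  intro x y h
  apply lcEv_inj
  apply hg
  rw [← lcEv_nat, h, lcEv_nat]

/-- every element killed by a power of `a` -/
def LCTors (a : Ideal R) (A : Type u) [AddCommGroup A] [Module R A] : Prop :=
  ∀ x : A, ∃ t : ℕ, ∀ r ∈ a ^ t, r • x = 0

lemma lc_zero_surj (a : Ideal R) (g : A →ₗ[R] B) (hg : Function.Surjective g) (hA : LCTors a A) :
    Function.Surjective (lcMap a 0 g) := by
  intro y
  obtain ⟨x, hx⟩ := hg (lcEv a B y)
  obtain ⟨t, ht⟩ := hA x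
  obtain ⟨z, hz⟩ := lcEv_surj a x t ht
  refine ⟨z, lcEv_inj a ?_⟩
  rw [lcEv_nat, hz, hx]

end LCax

section LCtors
variable {R : Type u} [CommRing R]

lemma exists_injective_embedding (R : Type u) [CommRing R] (N : Type u) [AddCommGroup N] [Module R N] :
    ∃ (E : Type u) (_ : AddCommGroup E) (_ : Module R E) (_ : Module.Injective R E) (f : N →ₗ[R] E),
      Function.Injective f := by
  obtain ⟨J, hJ, f, hf⟩ : ∃ (J : ModuleCat.{u} R) (_ : Injective J) (f : ModuleCat.of R N ⟶ J), Mono f :=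
    ⟨Injective.under (ModuleCat.of R N), inferInstance, Injective.ι _, inferInstance⟩
  have h2 : Injective (ModuleCat.of R J) := hJ
  have : Module.Injective R J := Module.injective_module_of_injective_object (R := R) (M := J)
  exact ⟨J, inferInstance, inferInstance, this, f.hom, (ModuleCat.mono_iff_injective _).1 hf⟩

/-- the torsion submodule -/
def lcΓ (a : Ideal R) (E : Type u) [AddCommGroup E] [Module R E] : Submodule R E where
  carrier := {x | ∃ t : ℕ, ∀ r ∈ a ^ t, r • x = 0}
  add_mem' := by
    rintro x y ⟨s, hs⟩ ⟨t, ht⟩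
    refine ⟨s + t, fun r hr => ?_⟩
    rw [smul_add, hs r (Ideal.pow_le_pow_right (Nat.le_add_right _ _) hr),
      ht r (Ideal.pow_le_pow_right (Nat.le_add_left _ _) hr), add_zero]
  zero_mem' := ⟨0, by simp⟩
  smul_mem' := by
    rintro c x ⟨s, hs⟩
    exact ⟨s, fun r hr => by rw [smul_comm, hs r hr, smul_zero]⟩

lemma lcΓ_tors (a : Ideal R) (E : Type u) [AddCommGroup E] [Module R E] : LCTors a (lcΓ a E) := by
  rintro ⟨x, t, ht⟩
  exact ⟨t, fun r hr => Subtype.ext (ht r hr)⟩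

lemma LCTors.uniform {a : Ideal R} {N : Type u} [AddCommGroup N] [Module R N] (h : LCTors a N)
    (S : Submodule R N) (hS : S.FG) : ∃ t : ℕ, ∀ r ∈ a ^ t, ∀ x ∈ S, r • x = 0 := by
  induction S, hS using Submodule.fg_induction with
  | singleton x =>
    obtain ⟨t, ht⟩ := h x
    refine ⟨t, fun r hr y hy => ?_⟩
    obtain ⟨c, rfl⟩ := Submodule.mem_span_singleton.1 hy
    rw [smul_comm, ht r hr, smul_zero]
  | sup M₁ M₂ _ _ h1 h2 =>
    obtain ⟨s, hs⟩ := h1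
    obtain ⟨t, ht⟩ := h2
    refine ⟨s + t, fun r hr y hy => ?_⟩
    obtain ⟨y1, hy1, y2, hy2, rfl⟩ := Submodule.mem_sup.1 hy
    rw [smul_add, hs r (Ideal.pow_le_pow_right (Nat.le_add_right _ _) hr) _ hy1,
      ht r (Ideal.pow_le_pow_right (Nat.le_add_left _ _) hr) _ hy2, add_zero]

lemma lcΓ_injective [IsNoetherianRing R] (a : Ideal R) (E : Type u) [AddCommGroup E] [Module R E]
    [Module.Injective R E] : Module.Injective R (lcΓ a E) := by
  apply Module.Baer.injective
  intro I f
  have hfg : (LinearMap.range f).FG := by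
    rw [LinearMap.range_eq_map]
    exact (IsNoetherian.noetherian ⊤).map f
  obtain ⟨t, ht⟩ := (lcΓ_tors a E).uniform (LinearMap.range f) hfg
  obtain ⟨k, hk⟩ := a.exists_pow_inf_eq_pow_smul (M := R) I
  have h1 : a ^ (k+t) ⊓ I ≤ a ^ t • I := by
    have := hk (k+t) (Nat.le_add_right _ _)
    rw [Nat.add_sub_cancel_left] at this
    have h2 : (a ^ (k+t) • ⊤ : Submodule R R) = a ^ (k+t) := by simp
    rw [h2] at this
    rw [this]
    exact Submodule.smul_mono le_rfl inf_le_right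
  have h2 : ∀ x : I, (x : R) ∈ a ^ t • I → f x = 0 := by
    rintro ⟨x, hx⟩ hx'
    simp only at hx'
    suffices h : ∀ x (hx' : x ∈ a ^ t • I), ∃ hx : x ∈ I, f ⟨x, hx⟩ = 0 from (h x hx').2
    intro x hx'
    induction hx' using Submodule.smul_induction_on' with
    | smul r hr y hy =>
      refine ⟨I.mul_mem_left r hy, ?_⟩
      have : (⟨r • y, I.mul_mem_left r hy⟩ : I) = r • ⟨y, hy⟩ := rfl
      rw [this, map_smul]
      exact ht r hr _ ⟨_, rfl⟩
    | add x hx y hy h1 h2 =>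
      obtain ⟨h1, h1'⟩ := h1
      obtain ⟨h2, h2'⟩ := h2
      refine ⟨I.add_mem h1 h2, ?_⟩
      have : (⟨x + y, I.add_mem h1 h2⟩ : I) = ⟨x, h1⟩ + ⟨y, h2⟩ := rfl
      rw [this, map_add, h1', h2', add_zero]
  let K : Submodule R I := Submodule.comap I.subtype (a ^ (k+t))
  let j : (I ⧸ K) →ₗ[R] (R ⧸ a ^ (k+t)) := Submodule.mapQ K (a ^ (k+t)) I.subtype le_rfl
  have hj : Function.Injective j := by
    rw [← LinearMap.ker_eq_bot]
    simp only [j, Submodule.mapQ, Submodule.ker_liftQ, K, LinearMap.ker_comp, Submodule.ker_mkQ]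
    exact Submodule.mkQ_map_self _
  let g : (I ⧸ K) →ₗ[R] E := Submodule.liftQ K ((lcΓ a E).subtype ∘ₗ f) (by
    intro x hx
    have : (x : R) ∈ a ^ t • I := h1 ⟨hx, x.2⟩
    rw [LinearMap.mem_ker, LinearMap.comp_apply, h2 x this, map_zero])
  obtain ⟨h, hh⟩ := Module.Injective.out j hj g
  refine ⟨LinearMap.codRestrict _ (h ∘ₗ Submodule.mkQ (a ^ (k+t))) ?_, ?_⟩
  · intro x
    refine ⟨k+t, fun r hr => ?_⟩
    rw [LinearMap.comp_apply, ← map_smul, ← map_smul, Submodule.mkQ_apply,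
      (Submodule.Quotient.mk_eq_zero _).2 (show r • x ∈ _ from Ideal.mul_mem_right _ _ hr), map_zero]
  · intro x hx
    apply Subtype.ext
    exact hh (Submodule.Quotient.mk ⟨x, hx⟩)

lemma LCTors.of_surjective {a : Ideal R} {N P : Type u} [AddCommGroup N] [Module R N] [AddCommGroup P]
    [Module R P] (h : LCTors a N) (f : N →ₗ[R] P) (hf : Function.Surjective f) : LCTors a P := by
  intro y
  obtain ⟨x, rfl⟩ := hf y
  obtain ⟨t, ht⟩ := h x
  exact ⟨t, fun r hr => by rw [← map_smul, ht r hr, map_zero]⟩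

theorem lc_tors_zero [IsNoetherianRing R] (a : Ideal R) (i : ℕ) : ∀ (N : Type u) [AddCommGroup N] [Module R N],
    LCTors a N → Subsingleton (LC a (i+1) N) := by
  induction i with
  | zero =>
    intro N _ _ hN
    obtain ⟨E, _, _, _, f, hf⟩ := exists_injective_embedding R N
    have := lcΓ_injective a E
    let f' : N →ₗ[R] lcΓ a E := f.codRestrict _ (fun x => by
      obtain ⟨t, ht⟩ := hN x
      exact ⟨t, fun r hr => by rw [← map_smul, ht r hr, map_zero]⟩)
    have hf' : Function.Injective f' := fun x y h => hf (congrArg Subtype.val h)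
    have hg := Submodule.mkQ_surjective (LinearMap.range f')
    obtain ⟨δ, h1, h2⟩ := lc_delta a 0 f' (LinearMap.range f').mkQ (LinearMap.exact_map_mkQ_range f') hf' hg
    have h3 := lc_zero_surj a _ hg (lcΓ_tors a E)
    have h4 := lc_injective (A := lcΓ a E) a 0
    refine subsingleton_of_forall_eq 0 fun x => ?_
    obtain ⟨y, rfl⟩ := (h2 x).1 (Subsingleton.elim _ _)
    obtain ⟨z, rfl⟩ := h3 y
    exact h1.apply_apply_eq_zero z
  | succ i ih =>
    intro N _ _ hN
    obtain ⟨E, _, _, _, f, hf⟩ := exists_injective_embedding R N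
    have := lcΓ_injective a E
    let f' : N →ₗ[R] lcΓ a E := f.codRestrict _ (fun x => by
      obtain ⟨t, ht⟩ := hN x
      exact ⟨t, fun r hr => by rw [← map_smul, ht r hr, map_zero]⟩)
    have hf' : Function.Injective f' := fun x y h => hf (congrArg Subtype.val h)
    have hg := Submodule.mkQ_surjective (LinearMap.range f')
    obtain ⟨δ, h1, h2⟩ := lc_delta a (i+1) f' (LinearMap.range f').mkQ (LinearMap.exact_map_mkQ_range f') hf' hg
    have h3 := ih _ ((lcΓ_tors a E).of_surjective _ hg)
    have h4 := lc_injective (A := lcΓ a E) a (i+1)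
    refine subsingleton_of_forall_eq 0 fun x => ?_
    obtain ⟨y, rfl⟩ := (h2 x).1 (Subsingleton.elim _ _)
    rw [Subsingleton.elim y 0, map_zero]
end LCtors

section V
variable {R : Type u} [CommRing R]

/-- prime filtration principle -/
lemma lcFilt [IsNoetherianRing R] (P : ∀ (N : Type u) [AddCommGroup N] [Module R N], Prop) (I : Ideal R)
    (h0 : ∀ (N : Type u) [AddCommGroup N] [Module R N], Subsingleton N → P N)
    (hp : ∀ p : Ideal R, p.IsPrime → I ≤ p → P (R ⧸ p))
    (hext : ∀ (A B C : Type u) [AddCommGroup A] [Module R A] [AddCommGroup B] [Module R B]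
      [AddCommGroup C] [Module R C] (f : A →ₗ[R] B) (g : B →ₗ[R] C), Function.Injective f →
      Function.Surjective g → Function.Exact f g → P A → P C → P B)
    (M : Type u) [AddCommGroup M] [Module R M] [hM : Module.Finite R M]
    (hI : I ≤ Module.annihilator R M) : P M := by
  revert hI
  refine IsNoetherianRing.induction_on_isQuotientEquivQuotientPrime (A := R) hM
    (motive := fun N _ _ _ => I ≤ Module.annihilator R N → P N) ?_ ?_ ?_
  · intro N _ _ _ hN _
    exact h0 N hN
  · intro N _ _ _ p e hN
    refine hext (R ⧸ p.asIdeal) N PUnit.{u+1} e.symm.toLinearMap 0 e.symm.injective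
      (fun x => ⟨0, rfl⟩) (fun x => ⟨fun _ => ⟨e x, e.symm_apply_apply x⟩, fun _ => rfl⟩)
      (hp _ p.2 ?_) (h0 _ inferInstance)
    intro x hx
    have h1 := Module.mem_annihilator.1 (hN hx) (e.symm 1)
    rw [← map_smul, LinearEquiv.map_eq_zero_iff] at h1
    rw [← Ideal.Quotient.eq_zero_iff_mem, ← h1]
    exact (mul_one _).symm
  · intro A _ _ _ B _ _ _ C _ _ _ f g hf hg h hA hC hB
    exact hext A B C f g hf hg h (hA (hB.trans (LinearMap.annihilator_le_of_injective f hf)))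
      (hC (hB.trans (LinearMap.annihilator_le_of_surjective g hg)))

lemma dim_lt_of_lt {p q : Ideal R} (hp : p.IsPrime) (h : p < q) :
    ringKrullDim (R ⧸ q) + 1 ≤ ringKrullDim (R ⧸ p) := by
  obtain ⟨x, hxq, hxp⟩ := SetLike.exists_of_lt h
  refine ringKrullDim_succ_le_of_surjective (Ideal.Quotient.factor h.le)
    (Ideal.Quotient.factor_surjective _) (r := Ideal.Quotient.mk p x) ?_ ?_
  · rw [mem_nonZeroDivisors_iff_ne_zero, Ne, Ideal.Quotient.eq_zero_iff_mem]
    exact hxp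
  · simpa [Ideal.Quotient.eq_zero_iff_mem] using hxq

/-- dimension below `d` on the closed set of `I` -/
def DimLT (I : Ideal R) (d : ℕ) : Prop := ∀ p : Ideal R, p.IsPrime → I ≤ p → ringKrullDim (R ⧸ p) < d

lemma DimLT.mono {I J : Ideal R} {d : ℕ} (h : DimLT I d) (hIJ : I ≤ J) : DimLT J d :=
  fun p hp hJ => h p hp (hIJ.trans hJ)

lemma dimLT_of_lt {p I : Ideal R} (hp : p.IsPrime) {d : ℕ} (h : ringKrullDim (R ⧸ p) < (d+1 : ℕ))
    (hI : p < I) : DimLT I d := by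
  intro q hq hIq
  have h1 := dim_lt_of_lt hp (hI.trans_le hIq)
  have h2 := h1.trans_lt h
  push_cast at h2
  by_contra h3
  rw [not_lt] at h3
  exact absurd (add_le_add_left h3 1) (not_le.2 h2)

/-- multiplication by `x` on a module -/
abbrev mulL (x : R) (M : Type u) [AddCommGroup M] [Module R M] : M →ₗ[R] M := x • LinearMap.id

lemma mulL_inj {p : Ideal R} (hp : p.IsPrime) {x : R} (hx : x ∉ p) :
    Function.Injective (mulL x (R ⧸ p)) := by
  rw [← LinearMap.ker_eq_bot, LinearMap.ker_eq_bot']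
  intro m hm
  obtain ⟨m, rfl⟩ := Ideal.Quotient.mk_surjective m
  have : Ideal.Quotient.mk p (x * m) = 0 := hm
  rw [Ideal.Quotient.eq_zero_iff_mem] at this ⊢
  exact (hp.mem_or_mem this).resolve_left hx

/-- `M / xM` -/
abbrev Qx (x : R) (M : Type u) [AddCommGroup M] [Module R M] : Type u := M ⧸ LinearMap.range (mulL x M)

lemma lcMap_mulL (a : Ideal R) (n : ℕ) (x : R) (M : Type u) [AddCommGroup M] [Module R M]
    (z : LC a n M) : lcMap a n (mulL x M) z = x • z := by
  rw [mulL, lcMap_smul, lcMap_id]; rfl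

lemma mem_ann_Qx (x : R) (M : Type u) [AddCommGroup M] [Module R M] :
    x ∈ Module.annihilator R (Qx x M) := by
  rw [Module.mem_annihilator]
  intro m
  obtain ⟨m, rfl⟩ := Submodule.mkQ_surjective _ m
  rw [← map_smul, Submodule.mkQ_apply, Submodule.Quotient.mk_eq_zero]
  exact ⟨m, rfl⟩

lemma ann_le_ann_Qx (x : R) (M : Type u) [AddCommGroup M] [Module R M] :
    Module.annihilator R M ≤ Module.annihilator R (Qx x M) :=
  LinearMap.annihilator_le_of_surjective _ (Submodule.mkQ_surjective _)

lemma lt_ann_Qx {p : Ideal R} {x : R} (hx : x ∉ p) :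
    p < Module.annihilator R (Qx x (R ⧸ p)) := by
  refine lt_of_le_of_ne ?_ fun h => hx (h ▸ mem_ann_Qx x (R ⧸ p))
  conv_lhs => rw [← Ideal.annihilator_quotient (I := p)]
  exact ann_le_ann_Qx x _

lemma lc_subsingleton_mid (a : Ideal R) (i : ℕ) {A B C : Type u} [AddCommGroup A] [Module R A]
    [AddCommGroup B] [Module R B] [AddCommGroup C] [Module R C] (f : A →ₗ[R] B) (g : B →ₗ[R] C)
    (hf : Function.Injective f) (hg : Function.Surjective g) (h : Function.Exact f g)
    (hA : Subsingleton (LC a i A)) (hC : Subsingleton (LC a i C)) : Subsingleton (LC a i B) := by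
  refine subsingleton_of_forall_eq 0 fun x => ?_
  obtain ⟨y, rfl⟩ := (lc_exact2 a i f g h hf hg x).1 (Subsingleton.elim _ _)
  rw [Subsingleton.elim y 0, map_zero]

lemma lc_subsingleton_of_subsingleton (a : Ideal R) (i : ℕ) (A : Type u) [AddCommGroup A] [Module R A]
    (h : Subsingleton A) : Subsingleton (LC a i A) := by
  refine subsingleton_of_forall_eq 0 fun x => ?_
  have h1 : lcMap a i (LinearMap.id : A →ₗ[R] A) x = x := by rw [lcMap_id]; rfl
  have h2 : (LinearMap.id : A →ₗ[R] A) = (0 : R) • LinearMap.id := LinearMap.ext fun y => Subsingleton.elim _ _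
  rw [h2, lcMap_smul, zero_smul] at h1
  exact h1.symm

lemma lcTors_of_le {a p : Ideal R} (h : a ≤ p) : LCTors a (R ⧸ p) := by
  intro x
  refine ⟨1, fun r hr => ?_⟩
  rw [pow_one] at hr
  obtain ⟨x, rfl⟩ := Ideal.Quotient.mk_surjective x
  show Ideal.Quotient.mk p (r * x) = 0
  rw [Ideal.Quotient.eq_zero_iff_mem]
  exact Ideal.mul_mem_right _ _ (h hr)

theorem lcV [IsNoetherianRing R] (a : Ideal R) (i : ℕ) : ∀ (M : Type u) [AddCommGroup M] [Module R M]
    [Module.Finite R M], DimLT (Module.annihilator R M) i → Subsingleton (LC a i M) := by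
  induction i with
  | zero =>
    intro M _ _ _ hM
    apply lc_subsingleton_of_subsingleton
    by_contra hne
    rw [not_subsingleton_iff_nontrivial] at hne
    have h1 : Module.annihilator R M ≠ ⊤ := fun h => by
      rw [Module.annihilator_eq_top_iff] at h
      exact not_subsingleton M h
    obtain ⟨p, hp, hle⟩ := Ideal.exists_le_maximal _ h1
    have := hM p hp.isPrime hle
    have h2 : Nontrivial (R ⧸ p) := Ideal.Quotient.nontrivial_iff.2 hp.ne_top
    exact absurd (ringKrullDim_nonneg_of_nontrivial (R := R ⧸ p)) (not_le.2 this)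
  | succ i ih =>
    intro M _ _ _ hM
    refine lcFilt (fun N _ _ => Subsingleton (LC a (i+1) N)) (Module.annihilator R M)
      (fun N _ _ h => lc_subsingleton_of_subsingleton a (i+1) N h) ?_
      (fun A B C _ _ _ _ _ _ f g hf hg h hA hC => lc_subsingleton_mid a (i+1) f g hf hg h hA hC) M le_rfl
    intro p hp hle
    by_cases hap : a ≤ p
    · exact lc_tors_zero a i _ (lcTors_of_le hap)
    obtain ⟨x, hxa, hxp⟩ := SetLike.not_le_iff_exists.1 hap
    obtain ⟨δ, h1, h2⟩ := lc_delta a i (mulL x (R ⧸ p)) _ (LinearMap.exact_map_mkQ_range _)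
      (mulL_inj hp hxp) (Submodule.mkQ_surjective _)
    have h3 := ih (Qx x (R ⧸ p)) (dimLT_of_lt hp (hM p hp hle) (lt_ann_Qx hxp))
    refine subsingleton_of_forall_eq 0 fun z => ?_
    have key : ∀ z : LC a (i+1) (R ⧸ p), x • z = 0 → z = 0 := by
      intro z hz
      rw [← lcMap_mulL] at hz
      obtain ⟨w, rfl⟩ := (h2 z).1 hz
      rw [Subsingleton.elim w 0, map_zero]
    obtain ⟨t, ht⟩ := lc_torsion a (i+1) hxa z
    induction t with
    | zero => simpa using ht
    | succ t iht =>
      apply iht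
      apply key
      rw [smul_smul, ← pow_succ', ht]

/-- Right exactness of the top cohomology. -/
lemma lc_right_surj [IsNoetherianRing R] (a : Ideal R) (n : ℕ) {A B C : Type u} [AddCommGroup A] [Module R A]
    [AddCommGroup B] [Module R B] [AddCommGroup C] [Module R C] [Module.Finite R A] (f : A →ₗ[R] B) (g : B →ₗ[R] C)
    (hf : Function.Injective f) (hg : Function.Surjective g) (h : Function.Exact f g)
    (hA : DimLT (Module.annihilator R A) (n+1)) : Function.Surjective (lcMap a n g) := by
  obtain ⟨δ, h1, h2⟩ := lc_delta a n f g h hf hg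
  have := lcV a (n+1) A hA
  intro z
  exact (h1 z).1 (Subsingleton.elim _ _)

lemma lc_surj [IsNoetherianRing R] (a : Ideal R) (n : ℕ) {B C : Type u}
    [AddCommGroup B] [Module R B] [AddCommGroup C] [Module R C] [Module.Finite R B] (g : B →ₗ[R] C)
    (hg : Function.Surjective g)
    (hB : DimLT (Module.annihilator R B) (n+1)) : Function.Surjective (lcMap a n g) :=
  lc_right_surj a n (LinearMap.ker g).subtype g (Submodule.subtype_injective _) hg
    (LinearMap.exact_subtype_ker_map g)
    (hB.mono (LinearMap.annihilator_le_of_injective _ (Submodule.subtype_injective _)))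

lemma lc_smul_ann (a : Ideal R) (n : ℕ) (A : Type u) [AddCommGroup A] [Module R A] {x : R}
    (hx : x ∈ Module.annihilator R A) (z : LC a n A) : x • z = 0 := by
  rw [← lcMap_mulL]
  have : mulL x A = (0 : R) • LinearMap.id := LinearMap.ext fun y => by
    simpa using Module.mem_annihilator.1 hx y
  rw [this, lcMap_smul, zero_smul]; rfl

/-- `x ∉ p` acts surjectively on top cohomology of a module on which it is regular -/
lemma lc_smul_surj [IsNoetherianRing R] (a : Ideal R) (n : ℕ) (A : Type u) [AddCommGroup A] [Module R A]
    [Module.Finite R A] (x : R) (hx : Function.Injective (mulL x A))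
    (hd : DimLT (Module.annihilator R (Qx x A)) n) (z : LC a n A) : ∃ w : LC a n A, x • w = z := by
  have h1 := lc_exact2 a n (mulL x A) _ (LinearMap.exact_map_mkQ_range _) hx (Submodule.mkQ_surjective _)
  have := lcV a n _ hd
  obtain ⟨w, hw⟩ := (h1 z).1 (Subsingleton.elim _ _)
  exact ⟨w, by rw [← lcMap_mulL, hw]⟩

lemma dimLT_Qx {p : Ideal R} (hp : p.IsPrime) {n : ℕ} (h : ringKrullDim (R ⧸ p) < (n+1 : ℕ)) {x : R} (hx : x ∉ p) :
    DimLT (Module.annihilator R (Qx x (R ⧸ p))) n := dimLT_of_lt hp h (lt_ann_Qx hx)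

end V

section Hull
variable {R : Type u} [CommRing R]

/-- `F` is essential over `K`, both inside `E`. -/
def EssOver {E : Type u} [AddCommGroup E] [Module R E] (K F : Submodule R E) : Prop :=
  K ≤ F ∧ ∀ x ∈ F, x ≠ 0 → ∃ r : R, r • x ∈ K ∧ r • x ≠ 0

lemma EssOver.trans {E : Type u} [AddCommGroup E] [Module R E] {K F G : Submodule R E}
    (h1 : EssOver K F) (h2 : EssOver F G) : EssOver K G := by
  refine ⟨h1.1.trans h2.1, fun x hx hx0 => ?_⟩
  obtain ⟨r, hr, hr0⟩ := h2.2 x hx hx0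
  obtain ⟨s, hs, hs0⟩ := h1.2 _ hr hr0
  exact ⟨s * r, by rwa [mul_smul], by rwa [mul_smul]⟩

lemma exists_max_ess {E : Type u} [AddCommGroup E] [Module R E] (K : Submodule R E) :
    ∃ F : Submodule R E, EssOver K F ∧ ∀ G, EssOver F G → G = F := by
  obtain ⟨F, hKF, hF⟩ := zorn_le_nonempty₀ {F : Submodule R E | EssOver K F} (by
    intro c hc hchain y hy
    refine ⟨sSup c, ⟨(hc hy).1.trans (le_sSup hy), ?_⟩, fun z hz => le_sSup hz⟩
    intro x hx hx0
    rw [Submodule.mem_sSup_of_directed ⟨y, hy⟩ hchain.directedOn] at hx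
    obtain ⟨F, hF, hx⟩ := hx
    exact (hc hF).2 x hx hx0) K ⟨le_rfl, fun x hx hx0 => ⟨1, by simpa using hx, by simpa using hx0⟩⟩
  exact ⟨F, hF.prop, fun G hG => le_antisymm (hF.2 (hF.prop.trans hG) hG.1) hG.1⟩

lemma exists_max_disj {E : Type u} [AddCommGroup E] [Module R E] (K : Submodule R E) :
    ∃ N : Submodule R E, (∀ x ∈ N, x ∈ K → x = 0) ∧
      ∀ N', N ≤ N' → (∀ x ∈ N', x ∈ K → x = 0) → N' = N := by
  obtain ⟨F, -, hF⟩ := zorn_le_nonempty₀ {N : Submodule R E | ∀ x ∈ N, x ∈ K → x = 0} (by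
    intro c hc hchain y hy
    refine ⟨sSup c, ?_, fun z hz => le_sSup hz⟩
    intro x hx hxK
    rw [Submodule.mem_sSup_of_directed ⟨y, hy⟩ hchain.directedOn] at hx
    obtain ⟨F, hF, hx⟩ := hx
    exact hc hF x hx hxK) ⊥ (fun x hx _ => by simpa using hx)
  exact ⟨F, hF.prop, fun G hG h => le_antisymm (hF.2 h hG) hG⟩

lemma injective_of_max_ess {E : Type u} [AddCommGroup E] [Module R E] [Module.Injective R E]
    (F : Submodule R E) (hF : ∀ G, EssOver F G → G = F) : Module.Injective R F := by
  obtain ⟨N, hN, hNm⟩ := exists_max_disj F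
  let j : F →ₗ[R] E ⧸ N := N.mkQ ∘ₗ F.subtype
  have hj : Function.Injective j := by
    rw [← LinearMap.ker_eq_bot, LinearMap.ker_eq_bot']
    intro x hx
    have : (x : E) ∈ N := (Submodule.Quotient.mk_eq_zero _).1 hx
    exact Subtype.ext (hN _ this x.2)
  obtain ⟨g, hg⟩ := Module.Injective.out j hj F.subtype
  -- essentiality of `j`
  have hess : ∀ z : E ⧸ N, z ≠ 0 → ∃ r : R, ∃ y : F, r • z = j y ∧ y ≠ 0 := by
    intro z hz
    obtain ⟨x, rfl⟩ := N.mkQ_surjective z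
    have hx : x ∉ N := fun h => hz ((Submodule.Quotient.mk_eq_zero _).2 h)
    have h1 : ¬ ∀ w ∈ N ⊔ R ∙ x, w ∈ F → w = 0 := fun h => by
      have := hNm _ le_sup_left h
      exact hx (this ▸ (Submodule.mem_sup_right (Submodule.mem_span_singleton_self x)))
    push Not at h1
    obtain ⟨w, hw, hwF, hw0⟩ := h1
    obtain ⟨n, hn, y, hy, rfl⟩ := Submodule.mem_sup.1 hw
    obtain ⟨r, rfl⟩ := Submodule.mem_span_singleton.1 hy
    refine ⟨r, ⟨_, hwF⟩, ?_, fun h => hw0 (congrArg Subtype.val h)⟩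
    show r • N.mkQ x = N.mkQ (n + r • x)
    rw [map_add, map_smul, Submodule.mkQ_apply N n, (Submodule.Quotient.mk_eq_zero _).2 hn, zero_add]
  have hginj : Function.Injective g := by
    rw [← LinearMap.ker_eq_bot, LinearMap.ker_eq_bot']
    intro z hz
    by_contra hz0
    obtain ⟨r, y, h1, h2⟩ := hess z hz0
    have := hg y
    rw [← h1, map_smul, hz, smul_zero] at this
    exact h2 (Subtype.ext this.symm)
  have hr : LinearMap.range g = F := by
    apply hF
    constructor
    · intro x hx
      exact ⟨j ⟨x, hx⟩, hg ⟨x, hx⟩⟩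
    · rintro _ ⟨z, rfl⟩ hz0
      obtain ⟨r, y, h1, h2⟩ := hess z (fun h => hz0 (by rw [h, map_zero]))
      refine ⟨r, ?_, ?_⟩
      · rw [← map_smul, h1, hg]; exact y.2
      · rw [← map_smul, h1, hg]; exact fun h => h2 (Subtype.ext h)
  let ρ : E →ₗ[R] F := (g ∘ₗ N.mkQ).codRestrict F (fun x => hr ▸ ⟨_, rfl⟩)
  have hρ : ∀ x : F, ρ x = x := fun x => Subtype.ext (hg x)
  constructor
  intro X Y _ _ _ _ f hf h
  obtain ⟨k, hk⟩ := Module.Injective.out f hf (F.subtype ∘ₗ h)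
  exact ⟨ρ ∘ₗ k, fun x => by
    rw [LinearMap.comp_apply, hk x]; exact hρ _⟩

/-- The injective hull of the residue field. -/
theorem exists_hull (R : Type u) [CommRing R] [IsLocalRing R] :
    ∃ (E : Type u) (_ : AddCommGroup E) (_ : Module R E) (_ : Module.Injective R E)
      (e : E), e ≠ 0 ∧ (∀ r ∈ IsLocalRing.maximalIdeal R, r • e = 0) ∧
      ∀ x : E, (∀ r ∈ IsLocalRing.maximalIdeal R, r • x = 0) → ∃ r : R, x = r • e := by
  let k := R ⧸ IsLocalRing.maximalIdeal R
  obtain ⟨E, _, _, _, f, hf⟩ := exists_injective_embedding R k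
  obtain ⟨F, hF, hFm⟩ := exists_max_ess (LinearMap.range f)
  have := injective_of_max_ess F hFm
  refine ⟨F, inferInstance, inferInstance, this, ⟨f 1, hF.1 ⟨1, rfl⟩⟩, ?_, ?_, ?_⟩
  · intro h
    have h1 : f 1 = 0 := congrArg Subtype.val h
    have h2 : (1 : k) = 0 := hf (by rw [h1, map_zero])
    exact one_ne_zero h2
  · intro r hr
    apply Subtype.ext
    show r • f 1 = 0
    rw [← map_smul]
    have : r • (1 : k) = 0 := by
      show Ideal.Quotient.mk _ (r * 1) = 0
      rw [mul_one, Ideal.Quotient.eq_zero_iff_mem]; exact hr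
    rw [this, map_zero]
  · intro x hx
    by_cases h0 : x = 0
    · exact ⟨0, by rw [h0, zero_smul]⟩
    obtain ⟨r, ⟨z, hz⟩, hr0⟩ := hF.2 x x.2 (fun h => h0 (Subtype.ext h))
    obtain ⟨c, rfl⟩ := Ideal.Quotient.mk_surjective z
    have hu : IsUnit r := by
      by_contra hu
      have := hx r ((IsLocalRing.mem_maximalIdeal r).2 hu)
      exact hr0 (congrArg Subtype.val this)
    obtain ⟨s, hs⟩ := hu.exists_left_inv
    refine ⟨s * c, Subtype.ext ?_⟩
    have h1 : Ideal.Quotient.mk (IsLocalRing.maximalIdeal R) c = c • (1 : k) := by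
      show _ = Ideal.Quotient.mk _ (c * 1)
      rw [mul_one]
    show (x : E) = (s * c) • f 1
    rw [mul_smul, ← map_smul, ← h1, hz, smul_smul, hs, one_smul]
end Hull

section Dual
variable {R : Type u} [CommRing R]

lemma adic_series [IsLocalRing R] [IsAdicComplete (IsLocalRing.maximalIdeal R) R] {y : R}
    (hy : y ∈ IsLocalRing.maximalIdeal R) (c : ℕ → R) :
    ∃ L : R, ∀ N : ℕ, ∃ d : R, L = ∑ k ∈ Finset.range N, y ^ k * c k + y ^ N * d := by
  set m := IsLocalRing.maximalIdeal R with hm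
  have key : ∀ c : ℕ → R, ∃ L : R, ∀ N : ℕ, L - ∑ k ∈ Finset.range N, y ^ k * c k ∈ m ^ N := by
    intro c
    obtain ⟨L, hL⟩ := IsPrecomplete.prec (I := m) (M := R) inferInstance
      (f := fun N => ∑ k ∈ Finset.range N, y ^ k * c k) (by
        intro i j hij
        rw [SModEq.sub_mem, smul_eq_mul, Ideal.mul_top, ← neg_mem_iff, neg_sub,
          ← Finset.sum_range_add_sum_Ico _ hij, add_sub_cancel_left]
        refine Ideal.sum_mem _ fun k hk => Ideal.mul_mem_right _ _ ?_
        exact Ideal.pow_le_pow_right (Finset.mem_Ico.1 hk).1 (Ideal.pow_mem_pow hy k))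
    refine ⟨L, fun N => ?_⟩
    have := hL N
    rw [SModEq.sub_mem, smul_eq_mul, Ideal.mul_top, ← neg_mem_iff, neg_sub] at this
    exact this
  obtain ⟨L, hL⟩ := key c
  refine ⟨L, fun N => ?_⟩
  obtain ⟨d, hd⟩ := key (fun k => c (N + k))
  refine ⟨d, ?_⟩
  rw [← sub_eq_zero]
  apply IsHausdorff.haus (I := m) (M := R) inferInstance
  intro M
  rw [SModEq.zero, smul_eq_mul, Ideal.mul_top]
  have h1 : L - (∑ k ∈ Finset.range N, y ^ k * c k + y ^ N * d)
      = (L - ∑ k ∈ Finset.range (N + M), y ^ k * c k)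
        - y ^ N * (d - ∑ k ∈ Finset.range M, y ^ k * c (N + k)) := by
    rw [Finset.sum_range_add, mul_sub, Finset.mul_sum]
    simp only [pow_add, mul_assoc]
    ring
  rw [h1]
  exact Ideal.sub_mem _ (Ideal.pow_le_pow_right (Nat.le_add_left _ _) (hL _)) (Ideal.mul_mem_left _ _ (hd M))

lemma finite_of_complete [IsNoetherianRing R] [IsLocalRing R] [IsAdicComplete (IsLocalRing.maximalIdeal R) R] {y : R}
    (hy : y ∈ IsLocalRing.maximalIdeal R) {W V : Type u} [AddCommGroup W] [Module R W]
    [AddCommGroup V] [Module R V] [Module.Finite R V] (f : W →ₗ[R] V)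
    (hf : ∀ w, f w = 0 → ∃ v, w = y • v) (hs : ∀ w : W, (∀ k : ℕ, ∃ v, w = y ^ k • v) → w = 0) :
    Module.Finite R W := by
  have hfin : Module.Finite R (LinearMap.range f) := inferInstance
  obtain ⟨r, g, hg⟩ := Module.Finite.exists_fin (R := R) (M := LinearMap.range f)
  have hlift : ∀ j, ∃ w : W, f w = g j := fun j => (g j).2
  choose b hb using hlift
  have step : ∀ w : W, ∃ c : Fin r → R, ∃ v : W, w = ∑ j, c j • b j + y • v := by
    intro w
    have h1 : (⟨f w, w, rfl⟩ : LinearMap.range f) ∈ Submodule.span R (Set.range g) := hg ▸ Submodule.mem_top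
    obtain ⟨c, hc⟩ := (Submodule.mem_span_range_iff_exists_fun R).1 h1
    have h2 : f (w - ∑ j, c j • b j) = 0 := by
      rw [map_sub, map_sum, sub_eq_zero]
      have := congrArg Subtype.val hc
      simp only [AddSubmonoidClass.coe_finsetSum, Submodule.coe_smul] at this
      rw [← this]
      exact Finset.sum_congr rfl fun j _ => by rw [map_smul, hb]
    obtain ⟨v, hv⟩ := hf _ h2
    exact ⟨c, v, by rw [← hv]; abel⟩
  choose c v hcv using step
  refine ⟨Submodule.fg_def.2 ⟨Set.range b, Set.finite_range b, ?_⟩⟩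
  rw [eq_top_iff]
  rintro w -
  let s : ℕ → W := fun k => v^[k] w
  have hs1 : ∀ k, s k = ∑ j, c (s k) j • b j + y • s (k+1) := by
    intro k
    have : s (k+1) = v (s k) := Function.iterate_succ_apply' v k w
    rw [this]; exact hcv _
  have hs2 : ∀ N, w = ∑ j, (∑ k ∈ Finset.range N, y ^ k * c (s k) j) • b j + y ^ N • s N := by
    intro N
    induction N with
    | zero => simp [s]
    | succ N ih =>
      rw [ih]
      conv_lhs => rw [hs1 N]
      simp only [Finset.sum_range_succ, add_smul, Finset.sum_add_distrib, smul_add, pow_succ, mul_smul,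
        Finset.smul_sum]
      abel
  choose L hL using fun j => adic_series hy (fun k => c (s k) j)
  have hw : w - ∑ j, L j • b j = 0 := by
    apply hs
    intro N
    choose d hd using fun j => hL j N
    refine ⟨s N - ∑ j, d j • b j, ?_⟩
    conv_lhs => rw [hs2 N]
    have : ∑ j, L j • b j = ∑ j, (∑ k ∈ Finset.range N, y ^ k * c (s k) j) • b j + y ^ N • ∑ j, d j • b j := by
      rw [Finset.smul_sum, ← Finset.sum_add_distrib]
      exact Finset.sum_congr rfl fun j _ => by rw [smul_smul, ← add_smul, ← hd j]
    rw [this, smul_sub]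
    abel
  rw [sub_eq_zero] at hw
  rw [hw]
  refine Submodule.sum_mem _ fun j _ => Submodule.smul_mem _ _ (Submodule.subset_span ?_)
  simp

variable {E : Type u} [AddCommGroup E] [Module R E] [Module.Injective R E]

lemma inj_factor {B C : Type u} [AddCommGroup B] [Module R B] [AddCommGroup C] [Module R C] (g : B →ₗ[R] C)
    (φ : B →ₗ[R] E) (h : ∀ x, g x = 0 → φ x = 0) : ∃ ψ : C →ₗ[R] E, ∀ x, ψ (g x) = φ x := by
  have hk : LinearMap.ker g ≤ LinearMap.ker φ := fun x hx => h x hx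
  let g' : (B ⧸ LinearMap.ker g) →ₗ[R] C := (LinearMap.ker g).liftQ g le_rfl
  have hg' : Function.Injective g' := LinearMap.ker_eq_bot.1 (Submodule.ker_liftQ_eq_bot _ _ _ le_rfl)
  obtain ⟨ψ, hψ⟩ := Module.Injective.out g' hg' ((LinearMap.ker g).liftQ φ hk)
  exact ⟨ψ, fun x => hψ (Submodule.Quotient.mk x)⟩

lemma dual_div {H : Type u} [AddCommGroup H] [Module R H] (y : R) (φ : H →ₗ[R] E)
    (h : ∀ x, y • x = 0 → φ x = 0) : ∃ ψ : H →ₗ[R] E, φ = y • ψ := by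
  obtain ⟨ψ, hψ⟩ := inj_factor (mulL y H) φ (fun x hx => h x hx)
  refine ⟨ψ, LinearMap.ext fun x => ?_⟩
  rw [← hψ x]
  show ψ (y • x) = y • ψ x
  rw [map_smul]

lemma dual_finite_mid [IsNoetherianRing R] {A B C : Type u} [AddCommGroup A] [Module R A]
    [AddCommGroup B] [Module R B] [AddCommGroup C] [Module R C] (f : A →ₗ[R] B) (g : B →ₗ[R] C)
    (h : Function.Exact f g) (hA : Module.Finite R (A →ₗ[R] E)) (hC : Module.Finite R (C →ₗ[R] E)) :
    Module.Finite R (B →ₗ[R] E) := by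
  have h1 : IsNoetherian R (A →ₗ[R] E) := inferInstance
  have h2 : IsNoetherian R (C →ₗ[R] E) := inferInstance
  have : IsNoetherian R (B →ₗ[R] E) := by
    refine isNoetherian_of_range_eq_ker (LinearMap.lcomp R E g) (LinearMap.lcomp R E f) ?_
    ext φ
    simp only [LinearMap.mem_range, LinearMap.mem_ker]
    constructor
    · rintro ⟨ψ, rfl⟩
      ext x
      simp [h.apply_apply_eq_zero]
    · intro hφ
      obtain ⟨ψ, hψ⟩ := inj_factor g φ (fun x hx => by
        obtain ⟨z, rfl⟩ := (h x).1 hx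
        exact LinearMap.congr_fun hφ z)
      exact ⟨ψ, LinearMap.ext hψ⟩
  infer_instance

lemma dual_exists [IsLocalRing R] {e : E} (he : ∀ r ∈ IsLocalRing.maximalIdeal R, r • e = 0)
    {H : Type u} [AddCommGroup H] [Module R H] {x : H} (hx : x ≠ 0) : ∃ φ : H →ₗ[R] E, φ x = e := by
  obtain ⟨ψ, hψ⟩ := inj_factor (LinearMap.toSpanSingleton R H x) (LinearMap.toSpanSingleton R E e) (by
    intro r hr
    rw [LinearMap.toSpanSingleton_apply] at hr ⊢
    apply he
    rw [IsLocalRing.mem_maximalIdeal]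
    intro hu
    exact hx ((hu.smul_eq_zero).1 hr))
  refine ⟨ψ, ?_⟩
  simpa using hψ 1
end Dual

section CF
variable {R : Type u} [CommRing R]

lemma dim_mono {p q : Ideal R} (h : p ≤ q) : ringKrullDim (R ⧸ q) ≤ ringKrullDim (R ⧸ p) :=
  ringKrullDim_le_of_surjective (Ideal.Quotient.factor h) (Ideal.Quotient.factor_surjective _)

lemma dimLT_of_prime {p : Ideal R} {d : ℕ} (h : ringKrullDim (R ⧸ p) < d) : DimLT p d :=
  fun _ _ hq => (dim_mono hq).trans_lt h

lemma dim_pos_of_ne [IsLocalRing R] {p : Ideal R} (hp : p.IsPrime) (h : p ≠ IsLocalRing.maximalIdeal R) :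
    1 ≤ ringKrullDim (R ⧸ p) := by
  have h1 := dim_lt_of_lt hp (lt_of_le_of_ne (IsLocalRing.le_maximalIdeal hp.ne_top) h)
  have h2 := ringKrullDim_nonneg_of_nontrivial (R := R ⧸ IsLocalRing.maximalIdeal R)
  refine le_trans ?_ h1
  simpa using add_le_add_left h2 1

/-- the only prime above both `a` and `p` is the maximal ideal -/
def SP [IsLocalRing R] (a p : Ideal R) : Prop :=
  ∀ Q : Ideal R, Q.IsPrime → a ≤ Q → p ≤ Q → Q = IsLocalRing.maximalIdeal R

lemma SP.mono [IsLocalRing R] {a p q : Ideal R} (h : SP a p) (hpq : p ≤ q) : SP a q :=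
  fun Q hQ ha hq => h Q hQ ha (hpq.trans hq)

/-- degree zero for a prime not containing `a` -/
lemma lc_zero_prime {a p : Ideal R} (hp : p.IsPrime) (h : ¬ a ≤ p) : Subsingleton (LC a 0 (R ⧸ p)) := by
  obtain ⟨y, hya, hyp⟩ := SetLike.not_le_iff_exists.1 h
  refine subsingleton_of_forall_eq 0 fun z => lcEv_inj a (A := R ⧸ p) ?_
  obtain ⟨t, ht⟩ := lcEv_tors a z
  have h1 := ht (y ^ t) (Ideal.pow_mem_pow hya t)
  have h2 : y ^ t ∉ p := fun h => hyp (hp.mem_of_pow_mem _ h)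
  rw [map_zero]
  exact mulL_inj hp h2 (by rw [map_zero]; exact h1)

/-- degree zero for the residue field -/
lemma lc_zero_residue [IsLocalRing R] {a : Ideal R} (ha : a ≤ IsLocalRing.maximalIdeal R) :
    ∃ h : LC a 0 (R ⧸ IsLocalRing.maximalIdeal R), h ≠ 0 ∧ ∀ z, ∃ r : R, z = r • h := by
  obtain ⟨h, hh⟩ := lcEv_surj a (1 : R ⧸ IsLocalRing.maximalIdeal R) 1 (fun r hr => by
    rw [pow_one] at hr
    show Ideal.Quotient.mk _ (r * 1) = 0
    rw [mul_one, Ideal.Quotient.eq_zero_iff_mem]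
    exact ha hr)
  refine ⟨h, fun h0 => ?_, fun z => ?_⟩
  · rw [h0, map_zero] at hh
    exact zero_ne_one hh
  · obtain ⟨r, hr⟩ := Ideal.Quotient.mk_surjective (lcEv a _ z)
    refine ⟨r, lcEv_inj a (A := R ⧸ IsLocalRing.maximalIdeal R) ?_⟩
    rw [map_smul, hh, ← hr]
    show _ = Ideal.Quotient.mk _ (r * 1)
    rw [mul_one]

lemma dual_subsingleton_finite {H E : Type u} [AddCommGroup H] [Module R H] [AddCommGroup E] [Module R E]
    (h : Subsingleton H) : Module.Finite R (H →ₗ[R] E) := by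
  have : Subsingleton (H →ₗ[R] E) := ⟨fun f g => LinearMap.ext fun x => by
    rw [Subsingleton.elim x 0, map_zero, map_zero]⟩
  infer_instance

lemma det_trick {W : Type u} [AddCommGroup W] [Module R W] [Module.Finite R W] (s y : R)
    (h : ∀ w : W, ∃ v, s • w = y • v) {Q : Ideal R} (hQ : Q.IsPrime) (hy : y ∈ Q)
    (hann : Module.annihilator R W ≤ Q) : s ∈ Q := by
  obtain ⟨P, hm, -, hc, hP⟩ := LinearMap.exists_monic_and_natDegree_eq_and_coeff_mem_pow_and_aeval_eq_zero
    R (algebraMap R (Module.End R W) s) (Ideal.span {y}) (by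
      rintro _ ⟨w, rfl⟩
      obtain ⟨v, hv⟩ := h w
      rw [Module.algebraMap_end_apply, hv]
      exact Submodule.smul_mem_smul (Ideal.mem_span_singleton_self y) Submodule.mem_top)
  rw [Polynomial.aeval_algebraMap_apply] at hP
  have h1 : P.eval s ∈ Q := by
    apply hann
    rw [Module.mem_annihilator]
    intro w
    have := LinearMap.congr_fun hP w
    simpa [Module.algebraMap_end_apply] using this
  rw [Polynomial.eval_eq_sum_range, Finset.sum_range_succ, hm.coeff_natDegree, one_mul] at h1
  have h2 : ∑ x ∈ Finset.range P.natDegree, P.coeff x * s ^ x ∈ Q := by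
    refine Ideal.sum_mem _ fun k hk => Ideal.mul_mem_right _ _ ?_
    have h3 := hc k
    have h4 : P.natDegree - k ≠ 0 := by
      have := Finset.mem_range.1 hk
      omega
    have h5 := Ideal.pow_le_self h4 h3
    exact (Ideal.span_singleton_le_iff_mem _).2 hy h5
  exact hQ.mem_of_pow_mem _ ((Ideal.add_mem_iff_right _ h2).1 h1)

variable [IsNoetherianRing R] [IsLocalRing R] [IsAdicComplete (IsLocalRing.maximalIdeal R) R]
variable {E : Type u} [AddCommGroup E] [Module R E] [Module.Injective R E] {e : E}

theorem lcCF (he0 : e ≠ 0) (he : ∀ r ∈ IsLocalRing.maximalIdeal R, r • e = 0)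
    (hsoc : ∀ x : E, (∀ r ∈ IsLocalRing.maximalIdeal R, r • x = 0) → ∃ r : R, x = r • e)
    {a : Ideal R} (ha : a ≤ IsLocalRing.maximalIdeal R) (i : ℕ) :
    ∀ (M : Type u) [AddCommGroup M] [Module R M] [Module.Finite R M],
      (∀ p : Ideal R, p.IsPrime → Module.annihilator R M ≤ p → SP a p ∨ ringKrullDim (R ⧸ p) < (i+1 : ℕ)) →
      Module.Finite R (LC a i M →ₗ[R] E) := by
  induction i with
  | zero =>
    intro M _ _ _ hM
    refine lcFilt (fun N _ _ => Module.Finite R (LC a 0 N →ₗ[R] E)) (Module.annihilator R M)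
      (fun N _ _ h => dual_subsingleton_finite (lc_subsingleton_of_subsingleton a 0 N h)) ?_
      (fun A B C _ _ _ _ _ _ f g hf hg h hA hC => dual_finite_mid _ _ (lc_exact2 a 0 f g h hf hg) hA hC) M le_rfl
    intro p hp hle
    by_cases hpm : p = IsLocalRing.maximalIdeal R
    · subst hpm
      obtain ⟨h, h0, hgen⟩ := lc_zero_residue ha
      obtain ⟨φ, hφ⟩ := dual_exists he h0
      have hmh : ∀ r ∈ IsLocalRing.maximalIdeal R, r • h = 0 := fun r hr =>
        lc_smul_ann a 0 _ (by rw [Ideal.annihilator_quotient]; exact hr) h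
      refine ⟨Submodule.fg_def.2 ⟨{φ}, Set.finite_singleton _, ?_⟩⟩
      rw [eq_top_iff]
      rintro ψ -
      obtain ⟨r, hr⟩ := hsoc (ψ h) (fun r hr => by rw [← map_smul, hmh r hr, map_zero])
      rw [Submodule.mem_span_singleton]
      refine ⟨r, LinearMap.ext fun z => ?_⟩
      obtain ⟨c, rfl⟩ := hgen z
      rw [map_smul, map_smul, hr, LinearMap.smul_apply, hφ]
    · have : ¬ a ≤ p := by
        intro hap
        rcases hM p hp hle with h | h
        · exact hpm (h p hp hap le_rfl)
        · exact absurd (dim_pos_of_ne hp hpm) (not_le.2 (by simpa using h))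
      exact dual_subsingleton_finite (lc_zero_prime hp this)
  | succ i ih =>
    intro M _ _ _ hM
    refine lcFilt (fun N _ _ => Module.Finite R (LC a (i+1) N →ₗ[R] E)) (Module.annihilator R M)
      (fun N _ _ h => dual_subsingleton_finite (lc_subsingleton_of_subsingleton a (i+1) N h)) ?_
      (fun A B C _ _ _ _ _ _ f g hf hg h hA hC => dual_finite_mid _ _ (lc_exact2 a (i+1) f g h hf hg) hA hC) M le_rfl
    intro p hp hle
    by_cases hap : a ≤ p
    · exact dual_subsingleton_finite (lc_tors_zero a i _ (lcTors_of_le hap))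
    obtain ⟨y, hya, hyp⟩ := SetLike.not_le_iff_exists.1 hap
    have hfin := ih (Qx y (R ⧸ p)) (by
      intro q hq hle'
      have hpq := (lt_ann_Qx hyp).trans_le hle'
      rcases hM p hp hle with h | h
      · exact Or.inl (h.mono hpq.le)
      · exact Or.inr (dimLT_of_lt hp h (lt_ann_Qx hyp) q hq hle'))
    obtain ⟨δ, h1, h2⟩ := lc_delta a i (mulL y (R ⧸ p)) _ (LinearMap.exact_map_mkQ_range _)
      (mulL_inj hp hyp) (Submodule.mkQ_surjective _)
    refine finite_of_complete (ha hya) (LinearMap.lcomp R E δ) ?_ ?_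
    · intro φ hφ
      apply dual_div
      intro x hx
      rw [← lcMap_mulL] at hx
      obtain ⟨w, rfl⟩ := (h2 x).1 hx
      exact LinearMap.congr_fun hφ w
    · intro φ hφ
      refine LinearMap.ext fun z => ?_
      obtain ⟨t, ht⟩ := lc_torsion a (i+1) hya z
      obtain ⟨v, rfl⟩ := hφ t
      rw [LinearMap.smul_apply, ← map_smul, ht, map_zero, LinearMap.zero_apply]

theorem lcLH (he0 : e ≠ 0) (he : ∀ r ∈ IsLocalRing.maximalIdeal R, r • e = 0)
    (hsoc : ∀ x : E, (∀ r ∈ IsLocalRing.maximalIdeal R, r • x = 0) → ∃ r : R, x = r • e)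
    {a : Ideal R} (ha : a ≤ IsLocalRing.maximalIdeal R) (n : ℕ) :
    ∀ p Q : Ideal R, p.IsPrime → Q.IsPrime → ringKrullDim (R ⧸ p) < (n+1+1 : ℕ) → a ≤ Q → p ≤ Q →
      Q ≠ IsLocalRing.maximalIdeal R → Subsingleton (LC a (n+1) (R ⧸ p)) := by
  induction n with
  | zero =>
    intro p Q hp hQ hd haQ hpQ hQm
    have : p = Q := by
      by_contra hne
      have h1 := dim_lt_of_lt hp (lt_of_le_of_ne hpQ hne)
      have h2 := dim_pos_of_ne hQ hQm
      have h3 := (add_le_add_left h2 1).trans_lt (h1.trans_lt hd)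
      norm_num at h3
    exact lc_tors_zero a 0 _ (lcTors_of_le (this ▸ haQ))
  | succ n ih =>
    intro p Q hp hQ hd haQ hpQ hQm
    by_cases hap : a ≤ p
    · exact lc_tors_zero a (n+1) _ (lcTors_of_le hap)
    obtain ⟨y, hya, hyp⟩ := SetLike.not_le_iff_exists.1 hap
    obtain ⟨s, hsQ, hs⟩ := lcFilt (fun N _ _ => ∃ s : R, s ∉ Q ∧ ∀ z : LC a (n+1) N, s • z = 0)
      (Module.annihilator R (Qx y (R ⧸ p)))
      (fun N _ _ h => ⟨1, hQ.one_notMem, fun z =>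
        (lc_subsingleton_of_subsingleton a (n+1) N h).elim _ _⟩) (by
        intro q hq hle
        have hpq := (lt_ann_Qx hyp).trans_le hle
        by_cases hqQ : q ≤ Q
        · have := ih q Q hq hQ (dimLT_of_lt hp hd hpq q hq le_rfl) haQ hqQ hQm
          exact ⟨1, hQ.one_notMem, fun z => Subsingleton.elim _ _⟩
        · obtain ⟨s, hsq, hsQ⟩ := SetLike.not_le_iff_exists.1 hqQ
          exact ⟨s, hsQ, fun z => lc_smul_ann a _ _ (by rw [Ideal.annihilator_quotient]; exact hsq) z⟩)
      (by
        rintro A B C _ _ _ _ _ _ f g hf hg h ⟨s, hsQ, hs⟩ ⟨t, htQ, ht⟩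
        refine ⟨s * t, fun h => (hQ.mem_or_mem h).elim hsQ htQ, fun z => ?_⟩
        have h1 : lcMap a (n+1) g (t • z) = 0 := by rw [map_smul, ht]
        obtain ⟨w, hw⟩ := (lc_exact2 a (n+1) f g h hf hg _).1 h1
        rw [mul_smul, ← hw, ← map_smul, hs, map_zero]) (Qx y (R ⧸ p)) le_rfl
    obtain ⟨δ, h1, h2⟩ := lc_delta a (n+1) (mulL y (R ⧸ p)) _ (LinearMap.exact_map_mkQ_range _)
      (mulL_inj hp hyp) (Submodule.mkQ_surjective _)
    have hfin : Module.Finite R (LC a (n+1+1) (R ⧸ p) →ₗ[R] E) :=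
      lcCF he0 he hsoc ha (n+1+1) (R ⧸ p) (fun q hq hle => Or.inr (by
        rw [Ideal.annihilator_quotient] at hle
        exact dimLT_of_prime hd q hq hle))
    by_contra hne
    rw [not_subsingleton_iff_nontrivial] at hne
    obtain ⟨z0, hz0⟩ := exists_ne (0 : LC a (n+1+1) (R ⧸ p))
    obtain ⟨φ, hφ⟩ := dual_exists he hz0
    refine hsQ (det_trick (W := LC a (n+1+1) (R ⧸ p) →ₗ[R] E) s y ?_ hQ (haQ hya) ?_)
    · intro ψ
      obtain ⟨v, hv⟩ := dual_div y (s • ψ) (fun x hx => by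
        rw [← lcMap_mulL] at hx
        obtain ⟨w, rfl⟩ := (h2 x).1 hx
        rw [LinearMap.smul_apply, ← map_smul, ← map_smul, hs, map_zero, map_zero])
      exact ⟨v, hv⟩
    · refine le_trans ?_ hpQ
      intro x hx
      by_contra hxp
      obtain ⟨w, hw⟩ := lc_smul_surj a (n+1+1) (R ⧸ p) x (mulL_inj hp hxp) (dimLT_Qx hp hd hxp) z0
      have h3 := LinearMap.congr_fun (Module.mem_annihilator.1 hx φ) w
      rw [LinearMap.smul_apply, ← map_smul, hw, hφ] at h3
      exact he0 h3
end CF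

section NV
variable {R : Type u} [CommRing R]

lemma series_dim (S : Set (PrimeSpectrum R)) (l : LTSeries S) :
    (l.length : WithBot ℕ∞) ≤ ringKrullDim (R ⧸ l.head.1.asIdeal) := by
  rw [ringKrullDim_quotient, Order.le_krullDim_iff]
  refine ⟨⟨l.length, fun i => ⟨(l i).1, ?_⟩, fun i => l.step i⟩, rfl⟩
  exact l.head_le i

lemma wb_add_one_le {a b : WithBot ℕ∞} (h : a + 1 ≤ b + 1) : a ≤ b := by
  by_contra h3
  rw [not_le] at h3
  cases a with
  | bot => simp at h3
  | coe a =>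
    cases b with
    | bot => 
      have : (a : WithBot ℕ∞) + 1 = ((a + 1 : ℕ∞) : WithBot ℕ∞) := rfl
      rw [this] at h
      simp at h
    | coe b =>
      have h1 : (a + 1 : ℕ∞) ≤ b + 1 := by exact_mod_cast h
      have h2 : b < a := by exact_mod_cast h3
      have hb : b ≠ ⊤ := h2.ne_top
      have := (ENat.add_le_add_iff_right ENat.one_ne_top).1 h1
      exact absurd h2 (not_lt.2 this)

lemma exists_prime_drop [IsNoetherianRing R] [IsLocalRing R] {p : Ideal R} (hp : p.IsPrime) {y : R}
    (hy : y ∈ IsLocalRing.maximalIdeal R) (hyp : y ∉ p) {n : ℕ} (hd : ringKrullDim (R ⧸ p) = (n+1 : ℕ)) :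
    ∃ q : Ideal R, q.IsPrime ∧ p ≤ q ∧ y ∈ q ∧ ringKrullDim (R ⧸ q) = n := by
  have h1 := Module.supportDim_le_supportDim_quotSMulTop_succ (M := R ⧸ p) hy
  rw [Module.supportDim_quotient_eq_ringKrullDim, hd, Nat.cast_add, Nat.cast_one] at h1
  have h2 := wb_add_one_le h1
  rw [Module.supportDim, Order.le_krullDim_iff] at h2
  obtain ⟨l, hl⟩ := h2
  have h3 := series_dim _ l
  have hsupp := l.head.2
  rw [Module.mem_support_iff_of_finite] at hsupp
  have hpq : p ≤ l.head.1.asIdeal := by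
    refine le_trans ?_ hsupp
    conv_lhs => rw [← Ideal.annihilator_quotient (I := p)]
    exact LinearMap.annihilator_le_of_surjective _ (Submodule.mkQ_surjective _)
  have hyq : y ∈ l.head.1.asIdeal := by
    apply hsupp
    rw [Module.mem_annihilator]
    intro m
    obtain ⟨m, rfl⟩ := Submodule.mkQ_surjective _ m
    rw [← map_smul, Submodule.mkQ_apply, Submodule.Quotient.mk_eq_zero]
    exact Submodule.smul_mem_pointwise_smul _ _ _ Submodule.mem_top
  refine ⟨_, l.head.1.2, hpq, hyq, le_antisymm ?_ (hl ▸ h3)⟩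
  have h4 := dim_lt_of_lt hp (lt_of_le_of_ne hpq fun h => hyp (h ▸ hyq))
  rw [hd, Nat.cast_add, Nat.cast_one] at h4
  exact wb_add_one_le h4

lemma lcMap_zero (a : Ideal R) (n : ℕ) (A B : Type u) [AddCommGroup A] [Module R A] [AddCommGroup B] [Module R B] :
    lcMap a n (0 : A →ₗ[R] B) = 0 := by
  have : (0 : A →ₗ[R] B) = (0 : R) • 0 := by simp
  rw [this, lcMap_smul, zero_smul]

lemma lcMap_sum (a : Ideal R) (n : ℕ) {A B : Type u} [AddCommGroup A] [Module R A] [AddCommGroup B] [Module R B]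
    {ι : Type} (s : Finset ι) (f : ι → (A →ₗ[R] B)) :
    lcMap a n (∑ i ∈ s, f i) = ∑ i ∈ s, lcMap a n (f i) := by
  classical
  induction s using Finset.induction_on with
  | empty => simp [lcMap_zero]
  | insert i s hi ih => rw [Finset.sum_insert hi, Finset.sum_insert hi, lcMap_add, ih]

lemma lc_surj_of_vanish (a : Ideal R) (n : ℕ) {B C : Type u} [AddCommGroup B] [Module R B]
    [AddCommGroup C] [Module R C] (g : B →ₗ[R] C) (hg : Function.Surjective g)
    (h : Subsingleton (LC a (n+1) (LinearMap.ker g))) : Function.Surjective (lcMap a n g) := by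
  obtain ⟨δ, h1, h2⟩ := lc_delta a n (LinearMap.ker g).subtype g (LinearMap.exact_subtype_ker_map g)
    (Submodule.subtype_injective _) hg
  intro z
  exact (h1 z).1 (Subsingleton.elim _ _)

lemma dual_reg_surj [IsLocalRing R] {E : Type u} [AddCommGroup E] [Module R E] [Module.Injective R E] {e : E}
    (he0 : e ≠ 0) (he : ∀ r ∈ IsLocalRing.maximalIdeal R, r • e = 0) {H : Type u} [AddCommGroup H] [Module R H]
    {y : R} (hreg : IsSMulRegular (H →ₗ[R] E) y) (z : H) : ∃ w : H, y • w = z := by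
  by_contra hz
  have hz' : (LinearMap.range (mulL y H)).mkQ z ≠ 0 := by
    rw [Submodule.mkQ_apply, Ne, Submodule.Quotient.mk_eq_zero]
    rintro ⟨w, hw⟩
    exact hz ⟨w, hw⟩
  obtain ⟨φ, hφ⟩ := dual_exists he hz'
  have h2 : φ ∘ₗ (LinearMap.range (mulL y H)).mkQ = 0 := hreg (by
    show y • _ = y • 0
    rw [smul_zero]
    refine LinearMap.ext fun w => ?_
    rw [LinearMap.smul_apply, LinearMap.comp_apply, ← map_smul,
      Module.mem_annihilator.1 (mem_ann_Qx y _), map_zero, LinearMap.zero_apply])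
  have h3 := LinearMap.congr_fun h2 z
  rw [LinearMap.comp_apply, hφ] at h3
  exact he0 h3

lemma dual_reg_ne [IsLocalRing R] {E : Type u} [AddCommGroup E] [Module R E] [Module.Injective R E] {e : E}
    (he0 : e ≠ 0) (he : ∀ r ∈ IsLocalRing.maximalIdeal R, r • e = 0) {H : Type u} [AddCommGroup H] [Module R H]
    [Nontrivial H] {y : R} (hreg : IsSMulRegular (H →ₗ[R] E) y) (h : ∀ z : H, y • z = 0) : False := by
  obtain ⟨z0, hz0⟩ := exists_ne (0 : H)
  obtain ⟨w, rfl⟩ := dual_reg_surj he0 he hreg z0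
  exact hz0 (h w)

variable [IsNoetherianRing R] [IsLocalRing R] [IsAdicComplete (IsLocalRing.maximalIdeal R) R]
variable {E : Type u} [AddCommGroup E] [Module R E] [Module.Injective R E] {e : E}

set_option maxHeartbeats 1000000 in
theorem lcNV (he0 : e ≠ 0) (he : ∀ r ∈ IsLocalRing.maximalIdeal R, r • e = 0)
    (hsoc : ∀ x : E, (∀ r ∈ IsLocalRing.maximalIdeal R, r • x = 0) → ∃ r : R, x = r • e)
    {a : Ideal R} (ha : a ≤ IsLocalRing.maximalIdeal R) (n : ℕ) :
    ∀ p : Ideal R, p.IsPrime → SP a p → ringKrullDim (R ⧸ p) = (n : ℕ) →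
      Nontrivial (LC a n (R ⧸ p)) := by
  induction n with
  | zero =>
    intro p hp hS hd
    have hpm : p = IsLocalRing.maximalIdeal R := by
      by_contra h
      have := dim_pos_of_ne hp h
      rw [hd] at this
      norm_num at this
    subst hpm
    obtain ⟨h, h0, -⟩ := lc_zero_residue ha
    exact ⟨h, 0, h0⟩
  | succ n ih =>
    intro p hp hS hd
    by_contra hsub
    rw [not_nontrivial_iff_subsingleton] at hsub
    have hd' : ringKrullDim (R ⧸ p) < (n+1+1 : ℕ) := by
      rw [hd]; exact_mod_cast Nat.lt_succ_self (n+1)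
    have hpm : p ≠ IsLocalRing.maximalIdeal R := by
      rintro rfl
      have h1 := ringKrullDim_eq_zero_of_field (IsLocalRing.ResidueField R)
      have h2 : ringKrullDim (IsLocalRing.ResidueField R) = _ := hd
      rw [h1] at h2
      have h3 : (0 : ℕ) = n + 1 := by exact_mod_cast h2
      omega
    have hvan : ∀ (N : Type u) [AddCommGroup N] [Module R N] [Module.Finite R N],
        p ≤ Module.annihilator R N → Subsingleton (LC a (n+1) N) := by
      intro N _ _ _ hN
      refine lcFilt (fun N _ _ => Subsingleton (LC a (n+1) N)) p
        (fun N _ _ h => lc_subsingleton_of_subsingleton a (n+1) N h) ?_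
        (fun A B C _ _ _ _ _ _ f g hf hg h hA hC => lc_subsingleton_mid a (n+1) f g hf hg h hA hC) N hN
      intro q hq hpq
      rcases eq_or_lt_of_le hpq with rfl | hlt
      · exact hsub
      · apply lcV
        rw [Ideal.annihilator_quotient]
        exact dimLT_of_lt hp hd' hlt
    have hsurj : ∀ {B C : Type u} [AddCommGroup B] [Module R B] [AddCommGroup C] [Module R C]
        [Module.Finite R B] (g : B →ₗ[R] C), Function.Surjective g → p ≤ Module.annihilator R B →
        Function.Surjective (lcMap a n g) := by
      intro B C _ _ _ _ _ g hg hB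
      exact lc_surj_of_vanish a n g hg (hvan _ (hB.trans
        (LinearMap.annihilator_le_of_injective _ (Submodule.subtype_injective _))))
    have hpp : p ≤ Module.annihilator R (R ⧸ p) := Ideal.annihilator_quotient.ge
    -- choose `y`
    obtain ⟨y, hym, hyp, hyS⟩ : ∃ y ∈ IsLocalRing.maximalIdeal R, y ∉ p ∧
        ∀ z : LC a n (R ⧸ p), ∃ w : LC a n (R ⧸ p), y • w = z := by
      by_cases hH : Subsingleton (LC a n (R ⧸ p))
      · obtain ⟨y, hym, hyp⟩ := SetLike.exists_of_lt
          (lt_of_le_of_ne (IsLocalRing.le_maximalIdeal hp.ne_top) hpm)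
        exact ⟨y, hym, hyp, fun z => ⟨0, Subsingleton.elim _ _⟩⟩
      have hn : n ≠ 0 := by
        rintro rfl
        exact hH (lc_zero_prime hp fun h => hpm (hS p hp h le_rfl))
      obtain ⟨n', rfl⟩ := Nat.exists_eq_succ_of_ne_zero hn
      have hfin : Module.Finite R (LC a (n'+1) (R ⧸ p) →ₗ[R] E) :=
        lcCF he0 he hsoc ha (n'+1) (R ⧸ p) (fun q hq hle => Or.inl (hS.mono (by
          rwa [Ideal.annihilator_quotient] at hle)))
      -- nothing killed by the maximal ideal
      have hm0 : ∀ φ : LC a (n'+1) (R ⧸ p) →ₗ[R] E, (∀ r ∈ IsLocalRing.maximalIdeal R, r • φ = 0) → φ = 0 := by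
        intro φ hφ
        obtain ⟨r, f, hf⟩ := Submodule.fg_iff_exists_fin_generating_family.1
          (IsNoetherian.noetherian (IsLocalRing.maximalIdeal R))
        let T : (Fin r → R ⧸ p) →ₗ[R] (R ⧸ p) := ∑ j, f j • LinearMap.proj j
        have hT : ∀ j (x : R ⧸ p), f j • x ∈ LinearMap.range T := by
          intro j x
          refine ⟨Pi.single j x, ?_⟩
          simp only [T, LinearMap.sum_apply, LinearMap.smul_apply, LinearMap.proj_apply]
          rw [Finset.sum_eq_single j]
          · simp
          · intro i _ hij
            rw [Pi.single_eq_of_ne hij, smul_zero]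
          · simp
        have hmT : ∀ s ∈ IsLocalRing.maximalIdeal R, ∀ x : R ⧸ p, s • x ∈ LinearMap.range T := by
          intro s hs x
          rw [← hf] at hs
          induction hs using Submodule.span_induction with
          | mem s hs => obtain ⟨j, rfl⟩ := hs; exact hT j x
          | zero => rw [zero_smul]; exact Submodule.zero_mem _
          | add s t _ _ h1 h2 => rw [add_smul]; exact Submodule.add_mem _ h1 h2
          | smul c s _ h1 => rw [smul_assoc]; exact Submodule.smul_mem _ _ h1
        have hQ : Subsingleton (LC a (n'+1) ((R ⧸ p) ⧸ LinearMap.range T)) := by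
          apply lc_tors_zero
          intro x
          refine ⟨1, fun s hs => ?_⟩
          rw [pow_one] at hs
          obtain ⟨x, rfl⟩ := Submodule.mkQ_surjective _ x
          rw [← map_smul, Submodule.mkQ_apply, Submodule.Quotient.mk_eq_zero]
          exact hmT s (ha hs) x
        refine LinearMap.ext fun z => ?_
        have hex := lc_exact2 a (n'+1) (LinearMap.range T).subtype (LinearMap.range T).mkQ
          (LinearMap.exact_subtype_mkQ _) (Submodule.subtype_injective _) (Submodule.mkQ_surjective _)
        obtain ⟨z', rfl⟩ := (hex z).1 (Subsingleton.elim _ _)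
        obtain ⟨b, rfl⟩ := hsurj T.rangeRestrict T.surjective_rangeRestrict (by
          intro s hs
          rw [Module.mem_annihilator]
          intro m
          ext j
          exact Module.mem_annihilator.1 (hpp hs) (m j)) z'
        have h5 : lcMap a (n'+1) (LinearMap.range T).subtype (lcMap a (n'+1) T.rangeRestrict b)
            = lcMap a (n'+1) T b := by
          rw [← LinearMap.comp_apply, ← lcMap_comp]; rfl
        rw [h5]
        simp only [T]
        rw [lcMap_sum, LinearMap.sum_apply, map_sum, LinearMap.zero_apply]
        refine Finset.sum_eq_zero fun j _ => ?_
        rw [lcMap_smul, LinearMap.smul_apply, map_smul, ← LinearMap.smul_apply, hφ, LinearMap.zero_apply]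
        rw [← hf]
        exact Submodule.subset_span ⟨j, rfl⟩
      have hhom : Subsingleton ((R ⧸ IsLocalRing.maximalIdeal R) →ₗ[R] (LC a (n'+1) (R ⧸ p) →ₗ[R] E)) := by
        refine subsingleton_of_forall_eq 0 fun ψ => ?_
        have h1 : ψ 1 = 0 := hm0 _ (fun r hr => by
          rw [← map_smul]
          have : r • (1 : R ⧸ IsLocalRing.maximalIdeal R) = 0 := by
            show Ideal.Quotient.mk _ (r * 1) = 0
            rw [mul_one, Ideal.Quotient.eq_zero_iff_mem]; exact hr
          rw [this, map_zero])
        refine LinearMap.ext fun c => ?_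
        obtain ⟨c, rfl⟩ := Ideal.Quotient.mk_surjective c
        have h2 : Ideal.Quotient.mk (IsLocalRing.maximalIdeal R) c = c • 1 := by
          show _ = Ideal.Quotient.mk _ (c * 1)
          rw [mul_one]
        rw [h2, map_smul, h1, smul_zero]; rfl
      obtain ⟨y, hy, hreg⟩ := IsSMulRegular.subsingleton_linearMap_iff.1 hhom
      rw [Ideal.annihilator_quotient] at hy
      rw [not_subsingleton_iff_nontrivial] at hH
      refine ⟨y, hy, ?_, ?_⟩
      · exact fun hyp => dual_reg_ne he0 he hreg fun z => lc_smul_ann a _ _ (hpp hyp) z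
      · exact dual_reg_surj he0 he hreg
    obtain ⟨q, hq, hpq, hyq, hdq⟩ := exists_prime_drop hp hym hyp hd
    have hnt := ih q hq (hS.mono hpq) hdq
    obtain ⟨z0, hz0⟩ := exists_ne (0 : LC a n (R ⧸ q))
    let g : (R ⧸ p) →ₗ[R] (R ⧸ q) := Submodule.factor hpq
    obtain ⟨w, rfl⟩ := hsurj g (Submodule.factor_surjective hpq) hpp z0
    obtain ⟨w', rfl⟩ := hyS w
    apply hz0
    rw [map_smul, lc_smul_ann a n _ (by rw [Ideal.annihilator_quotient]; exact hyq)]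
end NV

section ChoiceQ

lemma two_le_height {A : Type u} [CommRing A] [IsDomain A] {P P' : Ideal A} (hP : P.IsPrime) (hP' : P'.IsPrime)
    (h0 : P ≠ ⊥) (h : P < P') : ¬ P'.height ≤ 1 := by
  have hb : (⊥ : Ideal A).IsPrime := Ideal.isPrime_bot
  have h1 := Ideal.height_add_one_le_of_lt_of_isPrime (bot_lt_iff_ne_bot.2 h0)
  have h2 := Ideal.height_add_one_le_of_lt_of_isPrime h
  intro h3
  have h4 : (1:ℕ∞) ≤ P.height := le_trans le_add_self h1
  have h5 : (1:ℕ∞) + 1 ≤ 1 := (add_le_add_left h4 1).trans (h2.trans h3)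
  exact absurd h5 (by decide)

lemma dim_one_of_elt {A : Type u} [CommRing A] [IsDomain A] [IsNoetherianRing A] [IsLocalRing A] {g : A}
    (hg0 : g ≠ 0) (hg : ∀ P : Ideal A, P.IsPrime → P ≠ ⊥ → g ∈ P) (P : Ideal A) (hP : P.IsPrime)
    (hP0 : P ≠ ⊥) : P = IsLocalRing.maximalIdeal A := by
  by_contra hPm
  have hlt : P < IsLocalRing.maximalIdeal A := lt_of_le_of_ne (IsLocalRing.le_maximalIdeal hP.ne_top) hPm
  have hS : (Ideal.span {g}).minimalPrimes.Finite := Ideal.finite_minimalPrimes_of_isNoetherianRing _ _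
  have key : ¬ ((IsLocalRing.maximalIdeal A : Ideal A) : Set A) ⊆ ⋃ K ∈ hS.toFinset, (K : Set A) := by
    refine (Ideal.subset_union_prime ⊥ ⊥ ?_).not.mpr ?_
    · rintro K hK - -
      rw [Set.Finite.mem_toFinset] at hK
      exact hK.1.1
    · push Not
      intro K hK e
      rw [Set.Finite.mem_toFinset] at hK
      have := hK.1.1
      have h1 : K = IsLocalRing.maximalIdeal A := le_antisymm (IsLocalRing.le_maximalIdeal this.ne_top) e
      have h2 := Ideal.height_le_one_of_isPrincipal_of_mem_minimalPrimes _ _ hK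
      rw [h1] at h2
      exact two_le_height hP inferInstance hP0 hlt h2
  simp_rw [Set.not_subset, Set.mem_iUnion, not_exists, Set.Finite.mem_toFinset] at key
  obtain ⟨z, hzm, hz⟩ := key
  have hzle : Ideal.span {z} ≤ IsLocalRing.maximalIdeal A := by
    rwa [Ideal.span_le, Set.singleton_subset_iff]
  obtain ⟨P1, hP1, -⟩ := Ideal.exists_minimalPrimes_le hzle
  have hP1p : P1.IsPrime := hP1.1.1
  have hzP1 : z ∈ P1 := hP1.1.2 (Ideal.mem_span_singleton_self z)
  have hgle : Ideal.span {g} ≤ P := by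
    rw [Ideal.span_le, Set.singleton_subset_iff]; exact hg P hP hP0
  have hz0 : z ≠ 0 := by
    rintro rfl
    obtain ⟨P0, hP0, -⟩ := Ideal.exists_minimalPrimes_le hgle
    exact hz P0 hP0 (Ideal.zero_mem _)
  have hP10 : P1 ≠ ⊥ := by
    rintro rfl; exact hz0 (by simpa using hzP1)
  have hgle1 : Ideal.span {g} ≤ P1 := by
    rw [Ideal.span_le, Set.singleton_subset_iff]; exact hg P1 hP1p hP10
  obtain ⟨P2, hP2, h21⟩ := Ideal.exists_minimalPrimes_le hgle1
  have hP20 : P2 ≠ ⊥ := by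
    rintro rfl
    have := hP2.1.2 (Ideal.mem_span_singleton_self g)
    exact hg0 (by simpa using this)
  rcases h21.eq_or_lt with h | h
  · exact hz P2 hP2 (h ▸ hzP1)
  · exact two_le_height hP2.1.1 hP1p hP20 h
      (Ideal.height_le_one_of_isPrincipal_of_mem_minimalPrimes _ _ hP1)

lemma exists_Q {R : Type u} [CommRing R] [IsNoetherianRing R] [IsLocalRing R] {q : Ideal R} (hq : q.IsPrime)
    (hqm : q ≠ IsLocalRing.maximalIdeal R) {T : Set (Ideal R)} (hT : T.Finite) (h : ∀ p ∈ T, ¬ p ≤ q) :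
    ∃ Q : Ideal R, Q.IsPrime ∧ q ≤ Q ∧ Q ≠ IsLocalRing.maximalIdeal R ∧
      ∀ p ∈ T, ∀ Q' : Ideal R, Q'.IsPrime → Q ≤ Q' → p ≤ Q' → Q' = IsLocalRing.maximalIdeal R := by
  have h1 : ¬ (IsLocalRing.maximalIdeal R ⊓ hT.toFinset.inf id) ≤ q := by
    rw [hq.inf_le, Ideal.IsPrime.inf_le' hq]
    rintro (h2 | ⟨p, hp, hpq⟩)
    · exact hqm (le_antisymm (IsLocalRing.le_maximalIdeal hq.ne_top) h2)
    · exact h p (hT.mem_toFinset.1 hp) hpq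
  obtain ⟨g, hg, hgq⟩ := SetLike.not_le_iff_exists.1 h1
  obtain ⟨Q, ⟨hQ, hqQ, hgQ⟩, hmax⟩ := set_has_maximal_iff_noetherian.2 ‹IsNoetherianRing R›
    {Q : Ideal R | Q.IsPrime ∧ q ≤ Q ∧ g ∉ Q} ⟨q, hq, le_rfl, hgq⟩
  refine ⟨Q, hQ, hqQ, fun hh => hgQ (hh ▸ hg.1), ?_⟩
  intro p hp Q' hQ' hQQ' hpQ'
  have hgp : g ∈ p := by
    have := hg.2
    exact (Finset.inf_le (f := id) (hT.mem_toFinset.2 hp)) this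
  have hne : Q < Q' := lt_of_le_of_ne hQQ' fun hh => hgQ (hh ▸ hpQ' hgp)
  have : IsLocalRing (R ⧸ Q) := IsLocalRing.of_surjective' (Ideal.Quotient.mk Q) Ideal.Quotient.mk_surjective
  have hk : RingHom.ker (Ideal.Quotient.mk Q) ≤ Q' := by rw [Ideal.mk_ker]; exact hQQ'
  have hm : (Q'.map (Ideal.Quotient.mk Q)).comap (Ideal.Quotient.mk Q) = Q' := by
    rw [Ideal.comap_map_of_surjective' _ Ideal.Quotient.mk_surjective, Ideal.mk_ker]
    exact sup_eq_left.2 hQQ'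
  have hQm : (Q'.map (Ideal.Quotient.mk Q)).IsPrime :=
    Ideal.map_isPrime_of_surjective Ideal.Quotient.mk_surjective hk
  have := dim_one_of_elt (A := R ⧸ Q) (g := Ideal.Quotient.mk Q g)
    (by rwa [Ne, Ideal.Quotient.eq_zero_iff_mem]) ?_ (Q'.map (Ideal.Quotient.mk Q)) hQm ?_
  · have hmx : (Q'.map (Ideal.Quotient.mk Q)).IsMaximal := by rw [this]; infer_instance
    have := Ideal.comap_isMaximal_of_surjective (Ideal.Quotient.mk Q) Ideal.Quotient.mk_surjective
      (K := Q'.map (Ideal.Quotient.mk Q))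
    rw [hm] at this
    exact IsLocalRing.eq_maximalIdeal this
  · intro P hP hP0
    by_contra hgP
    have hPc : (P.comap (Ideal.Quotient.mk Q)).IsPrime := Ideal.comap_isPrime _ _
    have hQP : Q ≤ P.comap (Ideal.Quotient.mk Q) := fun x hx => by
      rw [Ideal.mem_comap, Ideal.Quotient.eq_zero_iff_mem.2 hx]; exact zero_mem _
    refine hmax _ ⟨hPc, hqQ.trans hQP, hgP⟩ (lt_of_le_of_ne hQP fun hh => hP0 ?_)
    rw [← Ideal.map_comap_of_surjective (Ideal.Quotient.mk Q) Ideal.Quotient.mk_surjective P, ← hh,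
      Ideal.map_quotient_self]
  · intro hh
    rw [hh, ← RingHom.ker_eq_comap_bot, Ideal.mk_ker] at hm
    exact hne.ne hm
end ChoiceQ

section Att
variable {R : Type u} [CommRing R]

lemma mem_ann_quot {N : Type u} [AddCommGroup N] [Module R N] {K : Submodule R N} {r : R} :
    r ∈ Module.annihilator R (N ⧸ K) ↔ ∀ x : N, r • x ∈ K := by
  rw [Module.mem_annihilator]
  constructor
  · intro h x
    have := h (Submodule.Quotient.mk x)
    rwa [← Submodule.Quotient.mk_smul, Submodule.Quotient.mk_eq_zero] at this
  · intro h m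
    obtain ⟨x, rfl⟩ := Submodule.Quotient.mk_surjective _ m
    rw [← Submodule.Quotient.mk_smul, Submodule.Quotient.mk_eq_zero]
    exact h x

lemma att_of_surj {N N' : Type u} [AddCommGroup N] [Module R N] [AddCommGroup N'] [Module R N']
    (f : N →ₗ[R] N') (hf : Function.Surjective f) : attachedPrimes R N' ⊆ attachedPrimes R N := by
  rintro p ⟨hp, K, rfl⟩
  refine ⟨hp, K.comap f, ?_⟩
  ext r
  rw [mem_ann_quot, mem_ann_quot]
  constructor
  · intro h x
    rw [Submodule.mem_comap, map_smul]; exact h _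
  · intro h y
    obtain ⟨x, rfl⟩ := hf y
    rw [← map_smul]; exact h x

lemma att_equiv {N N' : Type u} [AddCommGroup N] [Module R N] [AddCommGroup N'] [Module R N']
    (f : N ≃ₗ[R] N') : attachedPrimes R N = attachedPrimes R N' :=
  (att_of_surj f.symm.toLinearMap f.symm.surjective).antisymm (att_of_surj f.toLinearMap f.surjective)

lemma att_exact {A B C : Type u} [AddCommGroup A] [Module R A] [AddCommGroup B] [Module R B]
    [AddCommGroup C] [Module R C] (f : A →ₗ[R] B) (g : B →ₗ[R] C) (h : Function.Exact f g)
    (hg : Function.Surjective g) {p : Ideal R} (hp : p ∈ attachedPrimes R B) :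
    p ∈ attachedPrimes R A ∨ p ∈ attachedPrimes R C := by
  obtain ⟨hp, K, hK⟩ := hp
  have hA : p ≤ Module.annihilator R (A ⧸ K.comap f) := by
    intro r hr
    rw [hK, mem_ann_quot] at hr
    rw [mem_ann_quot]
    intro x
    rw [Submodule.mem_comap, map_smul]; exact hr _
  have hC : p ≤ Module.annihilator R (C ⧸ K.map g) := by
    intro r hr
    rw [hK, mem_ann_quot] at hr
    rw [mem_ann_quot]
    intro x
    obtain ⟨y, rfl⟩ := hg x
    rw [← map_smul]
    exact Submodule.mem_map_of_mem (hr y)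
  have hm : Module.annihilator R (A ⧸ K.comap f) * Module.annihilator R (C ⧸ K.map g) ≤ p := by
    rw [Ideal.mul_le]
    intro r hr s hs
    rw [mem_ann_quot] at hr hs
    rw [hK, mem_ann_quot]
    intro y
    obtain ⟨k, hk, hky⟩ := hs (g y)
    have h1 : g (s • y - k) = 0 := by rw [map_sub, map_smul, hky, sub_self]
    obtain ⟨x, hx⟩ := (h _).1 h1
    have h2 := hr x
    rw [Submodule.mem_comap, map_smul, hx, smul_sub, smul_smul] at h2
    have := K.add_mem h2 (K.smul_mem r hk)
    rwa [sub_add_cancel] at this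
  rcases hp.mul_le.1 hm with h1 | h1
  · exact Or.inl ⟨hp, _, le_antisymm hA h1⟩
  · exact Or.inr ⟨hp, _, le_antisymm hC h1⟩

lemma att_subsingleton {N : Type u} [AddCommGroup N] [Module R N] (h : Subsingleton N) {p : Ideal R}
    (hp : p ∈ attachedPrimes R N) : False := by
  obtain ⟨hp, K, hK⟩ := hp
  apply hp.ne_top
  rw [Ideal.eq_top_iff_one, hK, mem_ann_quot]
  intro x
  rw [Subsingleton.elim ((1:R) • x) 0]; exact zero_mem _

/-- a module killed by `q` on which elements outside `q` act surjectively -/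
lemma att_eq_of_coprimary {N : Type u} [AddCommGroup N] [Module R N] {q : Ideal R}
    (h1 : ∀ x ∈ q, ∀ z : N, x • z = 0) (h2 : ∀ x ∉ q, ∀ z : N, ∃ w : N, x • w = z) {p : Ideal R}
    (hp : p ∈ attachedPrimes R N) : p = q := by
  obtain ⟨hp, K, hK⟩ := hp
  refine le_antisymm ?_ ?_
  · intro x hx
    by_contra hxq
    apply hp.ne_top
    rw [Ideal.eq_top_iff_one, hK, mem_ann_quot]
    intro z
    rw [hK, mem_ann_quot] at hx
    obtain ⟨w, rfl⟩ := h2 x hxq z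
    rw [one_smul]
    exact hx w
  · intro x hx
    rw [hK, mem_ann_quot]
    intro z
    rw [h1 x hx]; exact zero_mem _

lemma att_of_coprimary {N : Type u} [AddCommGroup N] [Module R N] [Nontrivial N] {q : Ideal R} (hq : q.IsPrime)
    (h1 : ∀ x ∈ q, ∀ z : N, x • z = 0) (h2 : ∀ x ∉ q, ∀ z : N, ∃ w : N, x • w = z) :
    q ∈ attachedPrimes R N := by
  refine ⟨hq, ⊥, ?_⟩
  ext x
  rw [mem_ann_quot]
  constructor
  · intro hx z
    rw [h1 x hx]; exact zero_mem _
  · intro hx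
    by_contra hxq
    obtain ⟨z, hz⟩ := exists_ne (0 : N)
    obtain ⟨w, rfl⟩ := h2 x hxq z
    exact hz (by simpa using hx w)

lemma lc_prime_smul_surj [IsNoetherianRing R] (a : Ideal R) (n : ℕ) {q : Ideal R} (hq : q.IsPrime)
    (hd : ringKrullDim (R ⧸ q) < (n+1 : ℕ)) (J : Submodule R (R ⧸ q)) {x : R} (hx : x ∉ q)
    (z : LC a n J) : ∃ w, x • w = z := by
  refine lc_smul_surj a n J x ?_ ?_ z
  · intro u v huv
    apply Subtype.ext
    apply mulL_inj hq hx
    exact congrArg Subtype.val huv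
  · refine dimLT_of_lt hq hd (lt_of_le_of_ne ?_ fun h => hx (h ▸ mem_ann_Qx x J))
    refine le_trans ?_ (ann_le_ann_Qx x J)
    conv_lhs => rw [← Ideal.annihilator_quotient (I := q)]
    exact LinearMap.annihilator_le_of_injective J.subtype J.subtype_injective

/-- upper bound for attached primes -/
lemma att_lc_sub [IsNoetherianRing R] (a : Ideal R) (n : ℕ) (I : Ideal R) (M : Type u) [AddCommGroup M] [Module R M]
    [Module.Finite R M] (hI : I ≤ Module.annihilator R M) (hd : DimLT I (n+1)) (p : Ideal R)
    (hp : p ∈ attachedPrimes R (LC a n M)) :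
    p.IsPrime ∧ I ≤ p ∧ ringKrullDim (R ⧸ p) = (n:ℕ) ∧ Nontrivial (LC a n (R ⧸ p)) := by
  have key := lcFilt (R := R) (fun N _ _ => Module.Finite R N → DimLT (Module.annihilator R N) (n+1) →
    ∀ p ∈ attachedPrimes R (LC a n N),
    p.IsPrime ∧ I ≤ p ∧ ringKrullDim (R ⧸ p) = (n:ℕ) ∧ Nontrivial (LC a n (R ⧸ p))) I
    ?_ ?_ ?_ M hI
  · exact key inferInstance (hd.mono hI) p hp
  · intro N _ _ hN _ _ p hp
    exact (att_subsingleton (lc_subsingleton_of_subsingleton a n N hN) hp).elim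
  · intro q hq hIq _ hdq p hp
    have hnt : Nontrivial (LC a n (R ⧸ q)) := by
      by_contra hnt
      rw [not_nontrivial_iff_subsingleton] at hnt
      exact att_subsingleton hnt hp
    have hq1 : ringKrullDim (R ⧸ q) < (n+1 : ℕ) := hd q hq hIq
    have hpq : p = q := by
      refine att_eq_of_coprimary ?_ ?_ hp
      · intro x hx z
        exact lc_smul_ann a n _ (by rwa [Ideal.annihilator_quotient]) z
      · intro x hx z
        exact lc_smul_surj a n _ x (mulL_inj hq hx) (dimLT_Qx hq hq1 hx) z
    subst hpq
    refine ⟨hq, hIq, ?_, hnt⟩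
    by_contra hne
    have hlt : ringKrullDim (R ⧸ p) < (n : ℕ) := by
      refine lt_of_le_of_ne ?_ hne
      push_cast at hq1
      exact ENat.WithBot.lt_add_one_iff.1 hq1
    have := lcV a n (R ⧸ p) (by rw [Ideal.annihilator_quotient]; exact dimLT_of_prime hlt)
    exact not_subsingleton _ this
  · intro A B C _ _ _ _ _ _ f g hf hg h hA hC _ hdB p hp
    have hfC : Module.Finite R C := Module.Finite.of_surjective g hg
    have hfA : Module.Finite R A := Module.Finite.of_injective f hf
    rcases att_exact (lcMap a n f) (lcMap a n g) (lc_exact2 a n f g h hf hg) (lc_surj a n g hg hdB) hp with h1 | h1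
    · exact hA hfA (hdB.mono (LinearMap.annihilator_le_of_injective f hf)) p h1
    · exact hC hfC (hdB.mono (LinearMap.annihilator_le_of_surjective g hg)) p h1

lemma exists_map_ne_zero [IsNoetherianRing R] (M : Type u) [AddCommGroup M] [Module R M] [Module.Finite R M]
    {p : Ideal R} (hp : p.IsPrime) (h : Module.annihilator R M ≤ p) : ∃ f : M →ₗ[R] (R ⧸ p), f ≠ 0 := by
  by_contra hh
  push Not at hh
  have hs : Subsingleton (M →ₗ[R] (R ⧸ p)) := ⟨fun f g => by rw [hh f, hh g]⟩
  obtain ⟨r, hr, hreg⟩ := IsSMulRegular.subsingleton_linearMap_iff.1 hs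
  have h1 : r • (1 : R ⧸ p) = r • (0 : R ⧸ p) := by
    rw [smul_zero]
    have : r • (1 : R ⧸ p) = Ideal.Quotient.mk p r := by
      change Ideal.Quotient.mk p (r * 1) = _
      rw [mul_one]
    rw [this, Ideal.Quotient.eq_zero_iff_mem]
    exact h hr
  exact one_ne_zero (hreg h1)

lemma att_lc_mem [IsNoetherianRing R] (a : Ideal R) (n : ℕ) (M : Type u) [AddCommGroup M] [Module R M]
    [Module.Finite R M] (hd : DimLT (Module.annihilator R M) (n+1)) {p : Ideal R} (hp : p.IsPrime)
    (hI : Module.annihilator R M ≤ p) (hnt : Nontrivial (LC a n (R ⧸ p))) :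
    p ∈ attachedPrimes R (LC a n M) := by
  obtain ⟨f, hf⟩ := exists_map_ne_zero M hp hI
  have hd1 := hd p hp hI
  refine att_of_surj (lcMap a n f.rangeRestrict) (lc_surj a n _ f.surjective_rangeRestrict hd) ?_
  have hJ : Nontrivial (LC a n (LinearMap.range f)) := by
    by_contra hJ
    rw [not_nontrivial_iff_subsingleton] at hJ
    refine not_subsingleton (LC a n (R ⧸ p)) (lc_subsingleton_mid a n (LinearMap.range f).subtype
      (LinearMap.range f).mkQ (Submodule.subtype_injective _) (Submodule.mkQ_surjective _)
      (LinearMap.exact_subtype_mkQ _) hJ (lcV a n _ (dimLT_of_lt hp hd1 ?_)))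
    obtain ⟨m, hm⟩ : ∃ m, f m ≠ 0 := by
      by_contra h0
      push Not at h0
      exact hf (LinearMap.ext h0)
    obtain ⟨x, hx⟩ := Ideal.Quotient.mk_surjective (f m)
    refine lt_of_le_of_ne ?_ fun h => ?_
    · conv_lhs => rw [← Ideal.annihilator_quotient (I := p)]
      exact LinearMap.annihilator_le_of_surjective _ (Submodule.mkQ_surjective _)
    · apply hm
      rw [← hx, Ideal.Quotient.eq_zero_iff_mem, h, mem_ann_quot]
      intro y
      have : x • y = y.out • f m := by
        obtain ⟨y, rfl⟩ := Ideal.Quotient.mk_surjective y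
        rw [← hx]
        have e1 : x • Ideal.Quotient.mk p y = Ideal.Quotient.mk p x * Ideal.Quotient.mk p y := rfl
        have e2 : ∀ s : R, s • Ideal.Quotient.mk p x = Ideal.Quotient.mk p s * Ideal.Quotient.mk p x := fun _ => rfl
        rw [e1, e2, mul_comm]
        congr 1
        exact (Quotient.out_eq _).symm
      rw [this]
      exact Submodule.smul_mem _ _ ⟨m, rfl⟩
  refine att_of_coprimary hp ?_ ?_
  · intro x hx z
    refine lc_smul_ann a n _ ?_ z
    refine LinearMap.annihilator_le_of_injective _ (LinearMap.range f).subtype_injective ?_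
    rwa [Ideal.annihilator_quotient]
  · intro x hx z
    exact lc_prime_smul_surj a n hp hd1 _ hx z

end Att

lemma le_eq_of_dim {R : Type u} [CommRing R] {p q : Ideal R} (hp : p.IsPrime) (n : ℕ)
    (h1 : ringKrullDim (R ⧸ p) = (n:ℕ)) (h2 : ringKrullDim (R ⧸ q) = (n:ℕ)) (h : p ≤ q) : p = q := by
  by_contra hne
  have := dim_lt_of_lt hp (lt_of_le_of_ne h hne)
  rw [h1, h2] at this
  have h3 : ((n + 1 : ℕ) : WithBot ℕ∞) ≤ ((n : ℕ) : WithBot ℕ∞) := by exact_mod_cast this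
  have h4 : n + 1 ≤ n := by exact_mod_cast h3
  omega

theorem stmt0 (R : Type u) [CommRing R] [IsNoetherianRing R] [IsLocalRing R]
    [IsAdicComplete (IsLocalRing.maximalIdeal R) R]
    (M : Type u) [AddCommGroup M] [Module R M] [Module.Finite R M]
    (n : ℕ) (hn : 1 ≤ n)
    (hdim : ringKrullDim (R ⧸ Module.annihilator R M) = (n : WithBot (WithTop ℕ)))
    (T : Set (Ideal R)) (hT : T ⊆ assh R M n) :
    ∃ a : Ideal R,
      attachedPrimes R ((localCohomology a n).obj (ModuleCat.of R M)) = T := by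
  obtain ⟨E, _, _, _, e, he0, he, hsoc⟩ := exists_hull R
  have hfin : (assh R M n).Finite := (associatedPrimes.finite R M).subset fun p hp => hp.1
  have hTf : T.Finite := hfin.subset hT
  have hd0 : DimLT (Module.annihilator R M) (n+1) := by
    intro p hp hIp
    have h1 := dim_mono hIp
    have hdim' : ringKrullDim (R ⧸ Module.annihilator R M) = ((n : ℕ) : WithBot ℕ∞) := hdim
    rw [hdim'] at h1
    refine h1.trans_lt ?_
    have : n < n + 1 := by omega
    exact_mod_cast this
  have hprime : ∀ p ∈ assh R M n, p.IsPrime := fun p hp => hp.1.isPrime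
  have hann : ∀ p ∈ assh R M n, Module.annihilator R M ≤ p := fun p hp => by
    rw [← Submodule.annihilator_top]; exact hp.1.annihilator_le
  have hnm : ∀ p ∈ assh R M n, p ≠ IsLocalRing.maximalIdeal R := by
    rintro p hp rfl
    have h1 : ringKrullDim (R ⧸ IsLocalRing.maximalIdeal R) = ((n : ℕ) : WithBot ℕ∞) := hp.2
    have h2 : ringKrullDim (R ⧸ IsLocalRing.maximalIdeal R) = 0 :=
      ringKrullDim_eq_zero_of_field (IsLocalRing.ResidueField R)
    rw [h2] at h1
    have : 0 = n := by exact_mod_cast h1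
    omega
  have hQ : ∀ q : Ideal R, ∃ Q : Ideal R, q ∈ assh R M n \ T → (Q.IsPrime ∧ q ≤ Q ∧
      Q ≠ IsLocalRing.maximalIdeal R ∧ ∀ p ∈ T, ∀ Q' : Ideal R, Q'.IsPrime → Q ≤ Q' → p ≤ Q' →
        Q' = IsLocalRing.maximalIdeal R) := by
    intro q
    by_cases hq : q ∈ assh R M n \ T
    · obtain ⟨Q, h⟩ := exists_Q (hprime q hq.1) (hnm q hq.1) hTf (fun p hp hpq => by
        have := le_eq_of_dim (hprime p (hT hp)) n (hT hp).2 hq.1.2 hpq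
        exact hq.2 (this ▸ hp))
      exact ⟨Q, fun _ => h⟩
    · exact ⟨⊥, fun h => absurd h hq⟩
  choose Q hQ using hQ
  have hDf : (assh R M n \ T).Finite := hfin.subset Set.sdiff_subset
  let a : Ideal R := IsLocalRing.maximalIdeal R ⊓ hDf.toFinset.inf Q
  have ha : a ≤ IsLocalRing.maximalIdeal R := inf_le_left
  have haQ : ∀ q ∈ assh R M n \ T, a ≤ Q q := fun q hq =>
    inf_le_right.trans (Finset.inf_le (hDf.mem_toFinset.2 hq))
  have hSP : ∀ p ∈ T, SP a p := by
    intro p hp Q' hQ' haQ' hpQ'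
    rcases hQ'.inf_le.1 haQ' with h | h
    · exact le_antisymm (IsLocalRing.le_maximalIdeal hQ'.ne_top) h
    · obtain ⟨q, hq, hqQ⟩ := (Ideal.IsPrime.inf_le' hQ').1 h
      exact (hQ q (hDf.mem_toFinset.1 hq)).2.2.2 p hp Q' hQ' hqQ hpQ'
  refine ⟨a, ?_⟩
  obtain ⟨eq⟩ := lcComp a n hn M
  rw [← att_equiv eq]
  refine Set.Subset.antisymm ?_ ?_
  · intro p hp
    obtain ⟨hpp, hIp, hpd, hnt⟩ := att_lc_sub a n (Module.annihilator R M) M le_rfl hd0 p hp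
    have hmin : p ∈ (Module.annihilator R M).minimalPrimes := by
      refine ⟨⟨hpp, hIp⟩, ?_⟩
      rintro q ⟨hq, hIq⟩ hqp
      have h1 := hd0 q hq hIq
      have h2 : ringKrullDim (R ⧸ q) = (n:ℕ) := by
        refine le_antisymm ?_ (hpd ▸ dim_mono hqp)
        push_cast at h1
        exact ENat.WithBot.lt_add_one_iff.1 h1
      exact (le_eq_of_dim hq n h2 hpd hqp).ge
    have hass : p ∈ assh R M n :=
      ⟨Module.associatedPrimes.minimalPrimes_annihilator_subset_associatedPrimes R M hmin, hpd⟩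
    by_contra hpT
    obtain ⟨h1, h2, h3, -⟩ := hQ p ⟨hass, hpT⟩
    obtain ⟨k, rfl⟩ : ∃ k, n = k + 1 := ⟨n - 1, by omega⟩
    exact not_subsingleton _ (lcLH he0 he hsoc ha k p (Q p) hpp h1 (hd0 p hpp hIp) (haQ p ⟨hass, hpT⟩) h2 h3)
  · intro p hp
    have hpp := hprime p (hT hp)
    exact att_lc_mem a n M hd0 hpp (hann p (hT hp))
      (lcNV he0 he hsoc ha n p hpp (hSP p hp) (hT hp).2)

end
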